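/- For every oracle B, the parameterized decision problem (L₁^B, ||) belongs to PsubLIN^B, where L₁^B = { 10 1^i x : i ≥ 1, x ∈ Σ*, and 10 1^i x # 1u ∈ B }, with r_x = ⌈√|x|⌉, y_j = 1 0^{r_x−j} 1^j for j ∈ [r_x], u_j the membership bit B(10 1^i x # 0 y_j), and u = u₁u₂⋯u_{r_x}. -/

import Mathlib

open scoped Classical

/-! ## A model of oracle Turing machines

A machine has a read-only input tape (with endmarkers), a rewritable work tape
(only its cells count toward space usage), and a write-only query tape.
When the machine enters its query state with word `w` on the query tape,
the query tape is erased and the state becomes `qyes` if `w` is in the oracle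
and `qno` otherwise. -/

/-- Head moves. -/
inductive TMove | left | right | stay

/-- Apply a head move to a (ℕ-indexed) head position. -/
def TMove.app : TMove → ℕ → ℕ
  | .left, n => n - 1
  | .right, n => n + 1
  | .stay, n => n

/-- Symbols readable on the input tape: the endmarkers or an alphabet symbol. -/
inductive ISym (Γ : Type) | lend | rend | sym (a : Γ)

/-- Reading the input tape `|c x $` at position `i`. -/
def inputRead {Γ : Type} (x : List Γ) (i : ℕ) : ISym Γ :=
  if i = 0 then ISym.lend
  else
    match x[i - 1]? with
    | some a => ISym.sym a
    | none => ISym.rend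

/-- Result of one transition: new state, symbol written to the work tape,
input-head and work-head moves, and an optional symbol appended to the
write-only query tape. -/
structure TMOut (Γ : Type) (k : ℕ) where
  st : Fin k
  wr : Option Γ
  mi : TMove
  mw : TMove
  qw : Option Γ

/-- Configuration of an oracle machine with `k` states: current state, input
head position, work tape content and head position, current query-tape content,
and the maximal work-tape cell visited so far (the space used). -/
structure OCfg (Γ : Type) (k : ℕ) where
  state : Fin k
  ipos : ℕ
  work : ℕ → Option Γ
  wpos : ℕ
  qtape : List Γ
  maxw : ℕ

/-- Apply the result of a transition to a configuration. -/
def applyOut {Γ : Type} {k : ℕ} (c : OCfg Γ k) (o : TMOut Γ k) : OCfg Γ k :=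
  let w' := o.mw.app c.wpos
  { state := o.st
    ipos := o.mi.app c.ipos
    work := Function.update c.work c.wpos o.wr
    wpos := w'
    qtape := c.qtape ++ o.qw.toList
    maxw := max c.maxw w' }

/-- Deterministic oracle Turing machine (states are `Fin k`). -/
structure OTM (Γ : Type) where
  k : ℕ
  q0 : Fin k
  qacc : Fin k
  qrej : Fin k
  qquery : Fin k
  qyes : Fin k
  qno : Fin k
  δ : Fin k → ISym Γ → Option Γ → TMOut Γ k

/-- Initial configuration. -/
def OTM.init {Γ : Type} (M : OTM Γ) : OCfg Γ M.k :=
  ⟨M.q0, 0, fun _ => none, 0, [], 0⟩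

/-- One deterministic step, relative to oracle `A`, on input `x`.
Halting configurations are fixed; in the query state the oracle answers and the
query tape is erased. -/
noncomputable def OTM.step {Γ : Type} (M : OTM Γ) (A : Set (List Γ)) (x : List Γ)
    (c : OCfg Γ M.k) : OCfg Γ M.k :=
  if c.state = M.qacc ∨ c.state = M.qrej then c
  else if c.state = M.qquery then
    { c with state := if c.qtape ∈ A then M.qyes else M.qno, qtape := ([] : List Γ) }
  else applyOut c (M.δ c.state (inputRead x c.ipos) (c.work c.wpos))

/-- The configuration after `t` steps on input `x` with oracle `A`. -/
noncomputable def OTM.cfgAt {Γ : Type} (M : OTM Γ) (A : Set (List Γ)) (x : List Γ)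
    (t : ℕ) : OCfg Γ M.k :=
  (M.step A x)^[t] M.init

/-- A configuration is halting if its state is accepting or rejecting. -/
def OTM.Halted {Γ : Type} (M : OTM Γ) (c : OCfg Γ M.k) : Prop :=
  c.state = M.qacc ∨ c.state = M.qrej

/-- `M` with oracle `A` recognizes `L`, halting within time `T` (no space bound). -/
def OTM.DecidesT {Γ : Type} (M : OTM Γ) (A L : Set (List Γ)) (T : List Γ → ℝ) : Prop :=
  ∀ x, ∃ t : ℕ, (t : ℝ) ≤ T x ∧ M.Halted (M.cfgAt A x t) ∧
    (x ∈ L ↔ (M.cfgAt A x t).state = M.qacc)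

/-- `M` with oracle `A` recognizes `L`, halting within time `T` and using work
space at most `S` (note `maxw` is monotone along a run, so the bound at the
halting time bounds the whole computation). -/
def OTM.DecidesTS {Γ : Type} (M : OTM Γ) (A L : Set (List Γ)) (T S : List Γ → ℝ) : Prop :=
  ∀ x, ∃ t : ℕ, (t : ℝ) ≤ T x ∧ M.Halted (M.cfgAt A x t) ∧
    ((M.cfgAt A x t).maxw : ℝ) ≤ S x ∧
    (x ∈ L ↔ (M.cfgAt A x t).state = M.qacc)

/-- `M` (run with the empty oracle, its write-only query tape serving as a
write-only output tape) outputs `f x` on every input `x`, using work space at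
most `S x`. -/
def OTM.Outputs {Γ : Type} (M : OTM Γ) (f : List Γ → List Γ) (S : List Γ → ℝ) : Prop :=
  ∀ x, ∃ t : ℕ, (M.cfgAt ∅ x t).state = M.qacc ∧
    ((M.cfgAt ∅ x t).maxw : ℝ) ≤ S x ∧ (M.cfgAt ∅ x t).qtape = f x

/-- A log-space size parameter: some deterministic Turing machine with a
write-only output tape outputs `1^{m x}` on input `x` using `O(log |x|)` work
space (`o1` is the symbol `1` of the alphabet). -/
def LogSpaceSizeParam {Γ : Type} (o1 : Γ) (m : List Γ → ℕ) : Prop :=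
  ∃ (M : OTM Γ) (c : ℕ), M.Outputs (fun x => List.replicate (m x) o1)
    (fun x => c * Real.logb 2 (x.length + 2) + c)

/-- Nondeterministic oracle Turing machine. -/
structure ONTM (Γ : Type) where
  k : ℕ
  q0 : Fin k
  qacc : Fin k
  qrej : Fin k
  qquery : Fin k
  qyes : Fin k
  qno : Fin k
  δ : Fin k → ISym Γ → Option Γ → Set (TMOut Γ k)

/-- Initial configuration. -/
def ONTM.init {Γ : Type} (M : ONTM Γ) : OCfg Γ M.k :=
  ⟨M.q0, 0, fun _ => none, 0, [], 0⟩

/-- A configuration is halting if its state is accepting or rejecting. -/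
def ONTM.Halted {Γ : Type} (M : ONTM Γ) (c : OCfg Γ M.k) : Prop :=
  c.state = M.qacc ∨ c.state = M.qrej

/-- One nondeterministic step, relative to oracle `A`, on input `x`. -/
def ONTM.Step {Γ : Type} (M : ONTM Γ) (A : Set (List Γ)) (x : List Γ)
    (c c' : OCfg Γ M.k) : Prop :=
  (M.Halted c ∧ c' = c) ∨
  (¬ M.Halted c ∧ c.state = M.qquery ∧
    ((c.qtape ∈ A ∧ c' = { c with state := M.qyes, qtape := ([] : List Γ) }) ∨
     (c.qtape ∉ A ∧ c' = { c with state := M.qno, qtape := ([] : List Γ) }))) ∨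
  (¬ M.Halted c ∧ c.state ≠ M.qquery ∧
    ∃ o ∈ M.δ c.state (inputRead x c.ipos) (c.work c.wpos), c' = applyOut c o)

/-- A (computation path) run of `M` on `x` with oracle `A`. -/
def ONTM.IsRun {Γ : Type} (M : ONTM Γ) (A : Set (List Γ)) (x : List Γ)
    (r : ℕ → OCfg Γ M.k) : Prop :=
  r 0 = M.init ∧ ∀ t, M.Step A x (r t) (r (t + 1))

/-- `M` with oracle `A` recognizes `L` nondeterministically: every computation
path halts within time `T` and uses work space at most `S`, and `x ∈ L` iff
some computation path accepts. -/
def ONTM.DecidesTS {Γ : Type} (M : ONTM Γ) (A L : Set (List Γ)) (T S : List Γ → ℝ) : Prop :=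
  ∀ x,
    (∀ r, M.IsRun A x r → ∃ t : ℕ, (t : ℝ) ≤ T x ∧ M.Halted (r t)) ∧
    (∀ r, M.IsRun A x r → ∀ t : ℕ, (t : ℝ) ≤ T x → ((r t).maxw : ℝ) ≤ S x) ∧
    (x ∈ L ↔ ∃ r, M.IsRun A x r ∧ ∃ t : ℕ, (t : ℝ) ≤ T x ∧ (r t).state = M.qacc)

/-! ## Parameterized complexity classes relative to an oracle -/

/-- A parameterized decision problem: a language together with a size parameter. -/
abbrev ParaProblem (Γ : Type) := Set (List Γ) × (List Γ → ℕ)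

/-- The polynomial time bound `(|x| · m(x))^{O(1)}`. -/
def polyB {Γ : Type} (m : List Γ → ℕ) (c : ℕ) : List Γ → ℝ :=
  fun x => ((x.length * m x + 2 : ℕ) : ℝ) ^ c

/-- The logarithmic space bound `O(log (|x| · m(x)))`. -/
noncomputable def logB {Γ : Type} (m : List Γ → ℕ) (c : ℕ) : List Γ → ℝ :=
  fun x => c * Real.logb 2 (x.length * m x + 2) + c

/-- `para-L^A`: deterministic, polynomial time, logarithmic space. -/
def paraL {Γ : Type} (o1 : Γ) (A : Set (List Γ)) : Set (ParaProblem Γ) :=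
  { P | LogSpaceSizeParam o1 P.2 ∧
      ∃ (M : OTM Γ) (c : ℕ), M.DecidesTS A P.1 (polyB P.2 c) (logB P.2 c) }

/-- `para-NL^A`: nondeterministic, polynomial time, logarithmic space. -/
def paraNL {Γ : Type} (o1 : Γ) (A : Set (List Γ)) : Set (ParaProblem Γ) :=
  { P | LogSpaceSizeParam o1 P.2 ∧
      ∃ (M : ONTM Γ) (c : ℕ), M.DecidesTS A P.1 (polyB P.2 c) (logB P.2 c) }

/-- `para-P^A`: deterministic, polynomial time. -/
def paraP {Γ : Type} (o1 : Γ) (A : Set (List Γ)) : Set (ParaProblem Γ) :=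
  { P | LogSpaceSizeParam o1 P.2 ∧
      ∃ (M : OTM Γ) (c : ℕ), M.DecidesT A P.1 (polyB P.2 c) }

/-- `PsubLIN^A`: deterministic, polynomial time, sub-linear space
`O(m(x)^ε · log^k |x|)` for some `ε ∈ [0,1)` and `k ∈ ℕ`. -/
def PsubLIN {Γ : Type} (o1 : Γ) (A : Set (List Γ)) : Set (ParaProblem Γ) :=
  { P | LogSpaceSizeParam o1 P.2 ∧
      ∃ (M : OTM Γ) (c k : ℕ) (ε : ℝ), 0 ≤ ε ∧ ε < 1 ∧
        M.DecidesTS A P.1 (polyB P.2 c)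
          (fun x => c * (P.2 x : ℝ) ^ ε * Real.logb 2 (x.length + 2) ^ k + c) }

/-- `para-LOG²SPACE^A`: deterministic, time `|x|^{log|x|} · m(x)^{log m(x)}`,
space `O(log²|x| + log² m(x))`. -/
def paraLOG2 {Γ : Type} (o1 : Γ) (A : Set (List Γ)) : Set (ParaProblem Γ) :=
  { P | LogSpaceSizeParam o1 P.2 ∧
      ∃ (M : OTM Γ) (c : ℕ),
        M.DecidesTS A P.1
          (fun x => c * ((x.length + 2 : ℝ) ^ Real.logb 2 (x.length + 2)) *
              ((P.2 x + 2 : ℝ) ^ Real.logb 2 (P.2 x + 2)) + c)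
          (fun x => c * Real.logb 2 (x.length + 2) ^ 2 +
              c * Real.logb 2 (P.2 x + 2) ^ 2 + c) }

/-- `co-para-NL^A`: all `(L, m)` such that `(Σ* − L, m) ∈ para-NL^A`. -/
def coParaNL {Γ : Type} (o1 : Γ) (A : Set (List Γ)) : Set (ParaProblem Γ) :=
  { P | (P.1ᶜ, P.2) ∈ paraNL o1 A }

/-- An oracle `A` is NL-supportive if (1) `para-L^A ⊆ para-NL^A ⊆ para-P^A`,
(2) `para-NL^A = co-para-NL^A`, and (3) `para-NL^A ⊆ para-LOG²SPACE^A`. -/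
def NLSupportive {Γ : Type} (o1 : Γ) (A : Set (List Γ)) : Prop :=
  (paraL o1 A ⊆ paraNL o1 A ∧ paraNL o1 A ⊆ paraP o1 A) ∧
  paraNL o1 A = coParaNL o1 A ∧
  paraNL o1 A ⊆ paraLOG2 o1 A

/-- A recursive oracle: membership is decidable by a computable function. -/
def RecursiveOracle (A : Set (List Bool)) : Prop :=
  ∃ f : List Bool → Bool, Computable f ∧ ∀ w, w ∈ A ↔ f w = true

/-- Embedding of binary strings into strings over `{0, 1, #}`
(`# = (2 : Fin 3)`). -/
def emb (x : List Bool) : List (Fin 3) := x.map (fun b => if b then 1 else 0)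

/-- `r_x = ⌈√|x|⌉`. -/
noncomputable def rlen (x : List Bool) : ℕ := ⌈Real.sqrt x.length⌉₊

/-- `y_j = 1 0^{r_x − j} 1^j`. -/
noncomputable def ybit (x : List Bool) (j : ℕ) : List (Fin 3) :=
  1 :: (List.replicate (rlen x - j) 0 ++ List.replicate j 1)

/-- The string `10 1^i x`. -/
def word1 (i : ℕ) (x : List Bool) : List (Fin 3) :=
  1 :: 0 :: (List.replicate i 1 ++ emb x)

/-- `u = u₁u₂⋯u_{r_x}` where `u_j = B(10 1^i x # 0 y_j)`. -/
noncomputable def ubits (B : Set (List (Fin 3))) (i : ℕ) (x : List Bool) :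
    List (Fin 3) :=
  (List.range (rlen x)).map (fun j =>
    if word1 i x ++ 2 :: 0 :: ybit x (j + 1) ∈ B then 1 else 0)

/-- `L₁^B = { 10 1^i x : i ≥ 1, x ∈ Σ*, 10 1^i x # 1u ∈ B }`. -/
def L1 (B : Set (List (Fin 3))) : Set (List (Fin 3)) :=
  { w | ∃ i : ℕ, 1 ≤ i ∧ ∃ x : List Bool, w = word1 i x ∧
      word1 i x ++ 2 :: 1 :: ubits B i x ∈ B }

/-! ## Programs over an arbitrary finite state type -/

/-- The result of one transition of a program with state type `Q`. -/
structure Act (Γ Q : Type) where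
  st : Q
  wr : Option Γ
  mi : TMove
  mw : TMove
  qw : Option Γ

/-- A deterministic oracle machine with an arbitrary state type. -/
structure Prog (Γ Q : Type) where
  start : Q
  acc : Q
  rej : Q
  ask : Q
  yes : Q
  no : Q
  δ : Q → ISym Γ → Option Γ → Act Γ Q

/-- A configuration of a program, without the record of the space used. -/
structure Snap (Γ Q : Type) where
  state : Q
  ipos : ℕ
  work : ℕ → Option Γ
  wpos : ℕ
  qtape : List Γ

namespace Prog

variable {Γ Q : Type} [Fintype Q]

/-- The oracle machine obtained by numbering the states of a program. -/
noncomputable def toOTM (P : Prog Γ Q) : OTM Γ where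
  k := Fintype.card Q
  q0 := Fintype.equivFin Q P.start
  qacc := Fintype.equivFin Q P.acc
  qrej := Fintype.equivFin Q P.rej
  qquery := Fintype.equivFin Q P.ask
  qyes := Fintype.equivFin Q P.yes
  qno := Fintype.equivFin Q P.no
  δ q a g :=
    let o := P.δ ((Fintype.equivFin Q).symm q) a g
    ⟨Fintype.equivFin Q o.st, o.wr, o.mi, o.mw, o.qw⟩

/-- The machine configuration with snapshot `s` and space record `m`. -/
noncomputable def toCfg (P : Prog Γ Q) (s : Snap Γ Q) (m : ℕ) : OCfg Γ P.toOTM.k :=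
  ⟨Fintype.equivFin Q s.state, s.ipos, s.work, s.wpos, s.qtape, m⟩

/-- `u` is reached from `s` within `T` steps, visiting work cells up to `S` only. -/
def Reaches (P : Prog Γ Q) (A : Set (List Γ)) (x : List Γ) (S T : ℕ) (s u : Snap Γ Q) : Prop :=
  ∀ m ≤ S, ∃ t ≤ T, ∃ n ≤ S, (P.toOTM.step A x)^[t] (P.toCfg s m) = P.toCfg u n

/-- The states in which the transition function is applied. -/
def Running (P : Prog Γ Q) (q : Q) : Prop := q ≠ P.acc ∧ q ≠ P.rej ∧ q ≠ P.ask

variable {P : Prog Γ Q} {A : Set (List Γ)} {x : List Γ} {S T T' : ℕ} {s s' s'' : Snap Γ Q}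

theorem Reaches.refl (s : Snap Γ Q) : P.Reaches A x S 0 s s :=
  fun m hm => ⟨0, le_rfl, m, hm, rfl⟩

theorem Reaches.trans (h : P.Reaches A x S T s s') (h' : P.Reaches A x S T' s' s'') :
    P.Reaches A x S (T + T') s s'' := by
  intro m hm
  obtain ⟨t, ht, m', hm', e⟩ := h m hm
  obtain ⟨t', ht', m'', hm'', e'⟩ := h' m' hm'
  exact ⟨t' + t, by omega, m'', hm'', by rw [Function.iterate_add_apply, e, e']⟩

theorem Reaches.mono (h : P.Reaches A x S T s s') (hT : T ≤ T') : P.Reaches A x S T' s s' := by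
  intro m hm
  obtain ⟨t, ht, r⟩ := h m hm
  exact ⟨t, ht.trans hT, r⟩

theorem Reaches.act {q q' : Q} {i p : ℕ} {W : ℕ → Option Γ} {qt : List Γ} {wr qw : Option Γ}
    {mi mw : TMove} (hq : P.Running q)
    (hδ : P.δ q (inputRead x i) (W p) = ⟨q', wr, mi, mw, qw⟩) (hS : mw.app p ≤ S) :
    P.Reaches A x S 1 ⟨q, i, W, p, qt⟩
      ⟨q', mi.app i, Function.update W p wr, mw.app p, qt ++ qw.toList⟩ := by
  intro m hm
  obtain ⟨h1, h2, h3⟩ := hq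
  refine ⟨1, le_rfl, max m (mw.app p), max_le hm hS, ?_⟩
  simp [OTM.step, toCfg, toOTM, applyOut, h1, h2, h3, hδ]

theorem Reaches.query {i p : ℕ} {W : ℕ → Option Γ} {qt : List Γ}
    (h1 : P.ask ≠ P.acc) (h2 : P.ask ≠ P.rej) :
    P.Reaches A x S 1 ⟨P.ask, i, W, p, qt⟩
      ⟨if qt ∈ A then P.yes else P.no, i, W, p, []⟩ := by
  intro m hm
  refine ⟨1, le_rfl, m, hm, ?_⟩
  simp only [OTM.step, toCfg, toOTM, Function.iterate_one, EmbeddingLike.apply_eq_iff_eq, h1, h2,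
    or_self, if_false, if_true]
  split_ifs <;> rfl

end Prog

@[simp] theorem TMove.app_left (i : ℕ) : TMove.left.app i = i - 1 := rfl

@[simp] theorem TMove.app_right (i : ℕ) : TMove.right.app i = i + 1 := rfl

@[simp] theorem TMove.app_stay (i : ℕ) : TMove.stay.app i = i := rfl

theorem TMove.iterate_stay (n i : ℕ) : TMove.stay.app^[n] i = i := by
  induction n with
  | zero => rfl
  | succ n ih => rw [Function.iterate_succ_apply']; exact ih

theorem TMove.iterate_left (n i : ℕ) : TMove.left.app^[n] i = i - n := by
  induction n with
  | zero => rfl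
  | succ n ih => rw [Function.iterate_succ_apply', ih]; simp only [TMove.app]; omega

/-- The tape with the word `l` in the cells `1, …, |l|` and blanks elsewhere. -/
def tape {Γ : Type} (l : List Γ) (p : ℕ) : Option Γ :=
  if p = 0 then none else l[p - 1]?

section Tape

variable {Γ : Type}

@[simp] theorem tape_zero (l : List Γ) : tape l 0 = none := rfl

@[simp] theorem tape_nil : tape ([] : List Γ) = fun _ => none := by
  funext p; simp [tape]

theorem tape_end (l : List Γ) {p : ℕ} (hp : p = l.length + 1) : tape l p = none := by
  subst hp; simp [tape]

theorem tape_middle (a b : List Γ) (g : Γ) {p : ℕ} (hp : p = a.length + 1) :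
    tape (a ++ g :: b) p = some g := by
  subst hp; simp [tape]

theorem update_tape_middle (a b : List Γ) (g g' : Γ) {p : ℕ} (hp : p = a.length + 1) :
    Function.update (tape (a ++ g :: b)) p (some g') = tape (a ++ g' :: b) := by
  subst hp
  funext p
  rcases p with _ | p
  · simp [tape]
  · rcases lt_trichotomy p a.length with h | h | h
    · simp [tape, h.ne, List.getElem?_append_left h]
    · subst h; simp [tape]
    · obtain ⟨d, rfl⟩ := Nat.exists_eq_add_of_lt h
      have e1 : a.length + d + 1 - a.length = d + 1 := by omega
      have e2 : ¬ a.length + d + 1 < a.length := by omega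
      have e3 : a.length + d + 1 ≠ a.length := by omega
      simp [tape, List.getElem?_append, e1, e2, e3]

theorem update_tape_end (l : List Γ) (g : Γ) {p : ℕ} (hp : p = l.length + 1) :
    Function.update (tape l) p (some g) = tape (l ++ [g]) := by
  subst hp
  funext p
  rcases p with _ | p
  · simp [tape]
  · rcases lt_trichotomy p l.length with h | h | h
    · simp [tape, h.ne, List.getElem?_append_left h]
    · subst h; simp [tape]
    · simp [tape, h.ne', List.getElem?_append, show ¬ p < l.length by omega]
      omega

end Tape

namespace Prog

variable {Γ Q : Type} [Fintype Q] {P : Prog Γ Q} {A : Set (List Γ)} {x : List Γ} {S : ℕ}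

/-- A step that leaves the work tape unchanged. -/
theorem Reaches.keep {q q' : Q} {i i' p p' : ℕ} {W : ℕ → Option Γ} {qt qt' : List Γ}
    {g qw : Option Γ} {mi mw : TMove} (hq : P.Running q) (hg : W p = g)
    (hδ : P.δ q (inputRead x i) g = ⟨q', g, mi, mw, qw⟩) (hi : mi.app i = i') (hp : mw.app p = p')
    (hS : p' ≤ S) (hqt : qt ++ qw.toList = qt') :
    P.Reaches A x S 1 ⟨q, i, W, p, qt⟩ ⟨q', i', W, p', qt'⟩ := by
  subst hg hi hp hqt
  simpa using Reaches.act (A := A) (qt := qt) hq hδ hS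

theorem Reaches.walk_right {q : Q} {f : Γ → Γ} {em : Γ → Option Γ} {mi : TMove}
    (hq : P.Running q) (s : List Γ) (a b : List Γ) (i p : ℕ) (qt : List Γ)
    (hδ : ∀ g ∈ s, ∀ c, P.δ q c (some g) = ⟨q, some (f g), mi, .right, em g⟩)
    (hp : p = a.length + 1) (hS : a.length + s.length + 1 ≤ S) :
    P.Reaches A x S s.length ⟨q, i, tape (a ++ (s ++ b)), p, qt⟩
      ⟨q, mi.app^[s.length] i, tape (a ++ (s.map f ++ b)), a.length + s.length + 1,
        qt ++ s.filterMap em⟩ := by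
  induction s generalizing a i p qt with
  | nil => subst hp; simpa using Reaches.refl _
  | cons g s ih =>
    have e0 : P.δ q (inputRead x i) (tape (a ++ (g :: (s ++ b))) p) =
        ⟨q, some (f g), mi, .right, em g⟩ := by
      rw [tape_middle _ _ _ hp]; exact hδ g (by simp) _
    have h1 := Reaches.act (A := A) (S := S) (qt := qt) hq e0
      (by simp at hS ⊢; omega)
    rw [update_tape_middle _ _ _ _ hp] at h1
    have h2 := ih (a ++ [f g]) (mi.app i) (p + 1) (qt ++ (em g).toList)
      (fun g' hg' => hδ g' (by simp [hg'])) (by simp [hp]) (by simp at hS ⊢; omega)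
    have h3 := (h1.trans (by simpa using h2)).mono
      (T' := (g :: s).length) (by simp; omega)
    have e : (em g).toList ++ s.filterMap em = (g :: s).filterMap em := by
      cases h : em g <;> simp [h]
    have e2 : a.length + (g :: s).length + 1 = a.length + 1 + s.length + 1 := by simp; omega
    rw [e2]
    simpa [← e] using h3

theorem Reaches.walk_left {q : Q} {f : Γ → Γ} {em : Γ → Option Γ} {mi : TMove}
    (hq : P.Running q) (s : List Γ) (a b : List Γ) (i p : ℕ) (qt : List Γ)
    (hδ : ∀ g ∈ s, ∀ c, P.δ q c (some g) = ⟨q, some (f g), mi, .left, em g⟩)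
    (hp : p = a.length + s.length) (hS : a.length + s.length ≤ S) :
    P.Reaches A x S s.length ⟨q, i, tape (a ++ (s ++ b)), p, qt⟩
      ⟨q, mi.app^[s.length] i, tape (a ++ (s.map f ++ b)), a.length,
        qt ++ s.reverse.filterMap em⟩ := by
  induction s using List.reverseRecOn generalizing b i p qt with
  | nil => subst hp; simpa using Reaches.refl _
  | append_singleton s g ih =>
    have hp' : p = (a ++ s).length + 1 := by simp at hp ⊢; omega
    have e0 : P.δ q (inputRead x i) (tape ((a ++ s) ++ (g :: b)) p) =
        ⟨q, some (f g), mi, .left, em g⟩ := by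
      rw [tape_middle _ _ _ hp']; exact hδ g (by simp) _
    have h1 := Reaches.act (A := A) (S := S) (qt := qt) hq e0
      (by simp at hS hp ⊢; omega)
    rw [update_tape_middle _ _ _ _ hp'] at h1
    have h2 := ih (f g :: b) (mi.app i) (p - 1) (qt ++ (em g).toList)
      (fun g' hg' => hδ g' (by simp [hg'])) (by simp at hp ⊢; omega) (by simp at hS ⊢; omega)
    have h3 := (h1.trans (by simpa using h2)).mono
      (T' := (s ++ [g]).length) (by simp; omega)
    have e : (em g).toList ++ s.reverse.filterMap em = (s ++ [g]).reverse.filterMap em := by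
      cases h : em g <;> simp [h]
    rw [← e]
    simpa using h3

/-- A step, with the resulting configuration given up to provable equality. -/
theorem Reaches.step {q q' : Q} {i i' p p' : ℕ} {W W' : ℕ → Option Γ} {qt qt' : List Γ}
    {g wr qw : Option Γ} {mi mw : TMove} (hq : P.Running q) (hg : W p = g)
    (hδ : P.δ q (inputRead x i) g = ⟨q', wr, mi, mw, qw⟩) (hW : Function.update W p wr = W')
    (hi : mi.app i = i') (hp : mw.app p = p') (hS : p' ≤ S) (hqt : qt ++ qw.toList = qt') :
    P.Reaches A x S 1 ⟨q, i, W, p, qt⟩ ⟨q', i', W', p', qt'⟩ := by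
  subst hg hW hi hp hqt
  exact Reaches.act hq hδ hS

/-- A sweep to the right, with the configurations given up to provable equality. -/
theorem Reaches.sweep_right {q : Q} (f : Γ → Γ) (em : Γ → Option Γ) (mi : TMove)
    (hq : P.Running q) (s a b : List Γ) {T i i' p p' : ℕ} {qt qt' l l' : List Γ}
    (hδ : ∀ g ∈ s, ∀ c, P.δ q c (some g) = ⟨q, some (f g), mi, .right, em g⟩)
    (hl : a ++ (s ++ b) = l) (hl' : a ++ (s.map f ++ b) = l') (hp : p = a.length + 1)
    (hp' : a.length + s.length + 1 = p') (hi : mi.app^[s.length] i = i') (hS : p' ≤ S)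
    (hqt : qt ++ s.filterMap em = qt')
    (hT : s.length = T) :
    P.Reaches A x S T ⟨q, i, tape l, p, qt⟩ ⟨q, i', tape l', p', qt'⟩ := by
  subst hl hl' hp' hi hqt hT
  exact Reaches.walk_right hq s a b i p qt hδ hp hS

/-- A sweep to the left, with the configurations given up to provable equality. -/
theorem Reaches.sweep_left {q : Q} (f : Γ → Γ) (em : Γ → Option Γ) (mi : TMove)
    (hq : P.Running q) (s a b : List Γ) {T i i' p p' : ℕ} {qt qt' l l' : List Γ}
    (hδ : ∀ g ∈ s, ∀ c, P.δ q c (some g) = ⟨q, some (f g), mi, .left, em g⟩)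
    (hl : a ++ (s ++ b) = l) (hl' : a ++ (s.map f ++ b) = l') (hp : p = a.length + s.length)
    (hp' : a.length = p') (hi : mi.app^[s.length] i = i') (hS : p ≤ S)
    (hqt : qt ++ s.reverse.filterMap em = qt')
    (hT : s.length = T) :
    P.Reaches A x S T ⟨q, i, tape l, p, qt⟩ ⟨q, i', tape l', p', qt'⟩ := by
  subst hl hl' hp' hi hqt hT
  exact Reaches.walk_left hq s a b i p qt hδ hp (hp ▸ hS)

/-- A run from the initial configuration to a halting state gives the behaviour of the machine. -/
theorem Reaches.cfgAt {T : ℕ} {s : Snap Γ Q}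
    (h : P.Reaches A x S T ⟨P.start, 0, fun _ => none, 0, []⟩ s) :
    ∃ t ≤ T, (P.toOTM.cfgAt A x t).maxw ≤ S ∧
      (P.toOTM.cfgAt A x t).state = Fintype.equivFin Q s.state ∧
      (P.toOTM.cfgAt A x t).qtape = s.qtape := by
  obtain ⟨t, ht, m, hm, e⟩ := h 0 (Nat.zero_le _)
  have e' : P.toOTM.cfgAt A x t = P.toCfg s m := e
  exact ⟨t, ht, by rw [e']; exact hm, by rw [e']; rfl, by rw [e']; rfl⟩

end Prog

@[simp] theorem inputRead_zero {Γ : Type} (x : List Γ) : inputRead x 0 = .lend := rfl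

theorem inputRead_succ {Γ : Type} (x : List Γ) {i : ℕ} (h : i < x.length) :
    inputRead x (i + 1) = .sym x[i] := by
  simp [inputRead, h]

theorem inputRead_end {Γ : Type} (x : List Γ) : inputRead x (x.length + 1) = .rend := by
  simp [inputRead]

theorem inputRead_append {Γ : Type} (a b : List Γ) (g : Γ) :
    inputRead (a ++ g :: b) (a.length + 1) = .sym g := by
  simp [inputRead]

/-! ## The input length is a log-space size parameter -/

/-- States of the program that outputs the length of its input in unary. -/
inductive LenState | start | scan | acc | rej | ask

noncomputable instance : Fintype LenState :=
  ⟨{.start, .scan, .acc, .rej, .ask}, fun q => by cases q <;> simp⟩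

/-- The program that outputs the length of its input in unary. -/
def lenProg : Prog (Fin 3) LenState where
  start := .start
  acc := .acc
  rej := .rej
  ask := .ask
  yes := .rej
  no := .rej
  δ q a g :=
    match q with
    | .start => ⟨.scan, g, .right, .stay, none⟩
    | .scan =>
      match a with
      | .sym _ => ⟨.scan, g, .right, .stay, some 1⟩
      | _ => ⟨.acc, g, .stay, .stay, none⟩
    | q => ⟨q, g, .stay, .stay, none⟩

theorem lenProg_scan (A : Set (List (Fin 3))) (b a qt : List (Fin 3)) :
    lenProg.Reaches A (a ++ b) 0 (b.length + 1) ⟨.scan, a.length + 1, fun _ => none, 0, qt⟩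
      ⟨.acc, (a ++ b).length + 1, fun _ => none, 0, qt ++ List.replicate b.length 1⟩ := by
  have hq : lenProg.Running .scan := ⟨nofun, nofun, nofun⟩
  induction b generalizing a qt with
  | nil =>
    have h := Prog.Reaches.keep (A := A) (x := a ++ []) (S := 0) (i := a.length + 1) (p := 0)
      (W := fun _ => none) (qt := qt) (mi := .stay) (mw := .stay) (qw := none) (q' := .acc) hq rfl
      (by rw [List.append_nil, inputRead_end]; rfl) rfl rfl le_rfl rfl
    simpa using h
  | cons g b ih =>
    have h := Prog.Reaches.keep (A := A) (x := a ++ g :: b) (S := 0) (i := a.length + 1) (p := 0)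
      (W := fun _ => none) (qt := qt) (mi := .right) (mw := .stay) (qw := some 1) (q' := .scan)
      hq rfl (by rw [inputRead_append]; rfl) rfl rfl le_rfl rfl
    have h2 := ih (a ++ [g]) (qt ++ [1])
    refine Prog.Reaches.mono (T := 1 + (b.length + 1)) (h.trans ?_) (by simp [Nat.add_comm])
    simpa [List.replicate_succ] using h2

theorem logSpaceSizeParam_length :
    LogSpaceSizeParam (1 : Fin 3) (fun w : List (Fin 3) => w.length) := by
  refine ⟨lenProg.toOTM, 0, fun x => ?_⟩
  have h1 : lenProg.Reaches ∅ x 0 1 ⟨.start, 0, fun _ => none, 0, []⟩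
      ⟨.scan, 1, fun _ => none, 0, []⟩ :=
    Prog.Reaches.keep (mi := .right) (mw := .stay) (qw := none) ⟨nofun, nofun, nofun⟩ rfl rfl rfl
      rfl le_rfl rfl
  obtain ⟨t, -, hm, hs, ho⟩ := (h1.trans (lenProg_scan ∅ x [] [])).cfgAt
  refine ⟨t, hs, ?_, by simpa using ho⟩
  simpa using hm
/-! ## The search program -/

/-- States of the program deciding `L₁`. Those carrying a flag belong to the subroutine that moves
the input head left from the last input symbol by the square of the number of occupied work cells;
the flag selects the test that follows. -/
inductive SearchState
  | start | form1 | form2 | form3 | form4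
  | toEnd (b : Bool) | mark (b : Bool) | sweep (b : Bool) | back (b : Bool) | unmark (b : Bool)
  | low | low2 | low3
  | high1 | high2 | high3 | high4
  | ext | ext1 | ext2
  | rewind | copy
  | find | sep | zeros | ones
  | final | emit | final2
  | ask | yes | no | yes1 | no1 | ret | clear
  | acc | rej
  deriving Fintype

/-- The program deciding `L₁`. For `r = 0, 1, …` it keeps `r` work cells occupied. It tests whether
the suffix of length `r²` of the input leaves only ones after the first two symbols, and if so it
replaces the placeholders `2` in these cells by the oracle bits one by one and makes the final
query. It gives up when `r²` reaches the length of the longest possible suffix. -/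
def searchProg : Prog (Fin 3) SearchState where
  start := .start
  acc := .acc
  rej := .rej
  ask := .ask
  yes := .yes
  no := .no
  δ q a g :=
    match q with
    | .start => ⟨.form1, g, .right, .stay, none⟩
    | .form1 =>
      match a with
      | .sym 1 => ⟨.form2, g, .right, .stay, none⟩
      | _ => ⟨.rej, g, .stay, .stay, none⟩
    | .form2 =>
      match a with
      | .sym 0 => ⟨.form3, g, .right, .stay, none⟩
      | _ => ⟨.rej, g, .stay, .stay, none⟩
    | .form3 =>
      match a with
      | .sym 1 => ⟨.form4, g, .right, .stay, none⟩
      | _ => ⟨.rej, g, .stay, .stay, none⟩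
    | .form4 =>
      match a with
      | .sym 0 => ⟨.form4, g, .right, .stay, none⟩
      | .sym 1 => ⟨.form4, g, .right, .stay, none⟩
      | .rend => ⟨.toEnd false, g, .stay, .stay, none⟩
      | _ => ⟨.rej, g, .stay, .stay, none⟩
    | .toEnd b =>
      match a with
      | .rend => ⟨.mark b, g, .left, .right, none⟩
      | _ => ⟨.toEnd b, g, .right, .stay, none⟩
    | .mark b =>
      match g with
      | none => ⟨.unmark b, g, .stay, .left, none⟩
      | some 2 => ⟨.sweep b, some 1, .stay, .right, none⟩
      | some _ => ⟨.mark b, g, .stay, .right, none⟩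
    | .sweep b =>
      match g with
      | none => ⟨.back b, g, .stay, .left, none⟩
      | some _ => ⟨.sweep b, g, .left, .right, none⟩
    | .back b =>
      match g with
      | none => ⟨.mark b, g, .stay, .right, none⟩
      | some 2 => ⟨.back b, g, .stay, .left, none⟩
      | some _ => ⟨.back b, g, .left, .left, none⟩
    | .unmark b =>
      match g with
      | none => ⟨if b then .high1 else .low, g, .stay, .stay, none⟩
      | some _ => ⟨.unmark b, some 2, .stay, .left, none⟩
    | .low =>
      match a with
      | .lend => ⟨.rewind, g, .stay, .stay, none⟩
      | .sym 1 => ⟨.low, g, .left, .stay, none⟩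
      | _ => ⟨.low2, g, .left, .stay, none⟩
    | .low2 => ⟨.low3, g, .left, .stay, none⟩
    | .low3 =>
      match a with
      | .lend => ⟨.rewind, g, .stay, .stay, none⟩
      | _ => ⟨.ext, g, .stay, .stay, none⟩
    | .high1 => ⟨.high2, g, .left, .stay, none⟩
    | .high2 => ⟨.high3, g, .left, .stay, none⟩
    | .high3 => ⟨.high4, g, .left, .stay, none⟩
    | .high4 =>
      match a with
      | .lend => ⟨.rej, g, .stay, .stay, none⟩
      | _ => ⟨.ext, g, .stay, .stay, none⟩
    | .ext => ⟨.ext1, g, .stay, .right, none⟩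
    | .ext1 =>
      match g with
      | none => ⟨.ext2, some 2, .stay, .left, none⟩
      | some _ => ⟨.ext1, g, .stay, .right, none⟩
    | .ext2 =>
      match g with
      | none => ⟨.toEnd false, g, .stay, .stay, none⟩
      | some _ => ⟨.ext2, g, .stay, .left, none⟩
    | .rewind =>
      match a with
      | .lend => ⟨.copy, g, .right, .stay, none⟩
      | _ => ⟨.rewind, g, .left, .stay, none⟩
    | .copy =>
      match a with
      | .sym c => ⟨.copy, g, .right, .stay, some c⟩
      | _ => ⟨.find, g, .stay, .right, some 2⟩
    | .find =>
      match g with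
      | none => ⟨.final, g, .stay, .left, some 1⟩
      | some 2 => ⟨.sep, g, .stay, .stay, some 0⟩
      | some _ => ⟨.find, g, .stay, .right, none⟩
    | .sep => ⟨.zeros, g, .stay, .right, some 1⟩
    | .zeros =>
      match g with
      | none => ⟨.ones, g, .stay, .left, some 1⟩
      | some _ => ⟨.zeros, g, .stay, .right, some 0⟩
    | .ones =>
      match g with
      | none => ⟨.ask, g, .stay, .stay, none⟩
      | some 2 => ⟨.ones, g, .stay, .left, none⟩
      | some _ => ⟨.ones, g, .stay, .left, some 1⟩
    | .final =>
      match g with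
      | none => ⟨.emit, g, .stay, .right, none⟩
      | some _ => ⟨.final, g, .stay, .left, none⟩
    | .emit =>
      match g with
      | none => ⟨.final2, g, .stay, .left, none⟩
      | some c => ⟨.emit, g, .stay, .right, some c⟩
    | .final2 =>
      match g with
      | none => ⟨.ask, g, .stay, .stay, none⟩
      | some _ => ⟨.final2, g, .stay, .left, none⟩
    | .yes => ⟨.yes1, g, .stay, .right, none⟩
    | .yes1 =>
      match g with
      | none => ⟨.acc, g, .stay, .stay, none⟩
      | some 2 => ⟨.ret, some 1, .stay, .left, none⟩
      | some _ => ⟨.yes1, g, .stay, .right, none⟩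
    | .no => ⟨.no1, g, .stay, .right, none⟩
    | .no1 =>
      match g with
      | none => ⟨.clear, g, .stay, .left, none⟩
      | some 2 => ⟨.ret, some 0, .stay, .left, none⟩
      | some _ => ⟨.no1, g, .stay, .right, none⟩
    | .ret =>
      match g with
      | none => ⟨.rewind, g, .stay, .stay, none⟩
      | some _ => ⟨.ret, g, .stay, .left, none⟩
    | .clear =>
      match g with
      | none => ⟨.toEnd true, g, .stay, .stay, none⟩
      | some _ => ⟨.clear, some 2, .stay, .left, none⟩
    | q => ⟨q, g, .stay, .stay, none⟩

section SearchProg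

variable {B : Set (List (Fin 3))} {w : List (Fin 3)} {S : ℕ}

theorem searchProg_pass (b : Bool) (k s i : ℕ) (qt : List (Fin 3)) (hS : k + s + 2 ≤ S) :
    searchProg.Reaches B w S (2 * (k + s + 1) + 2)
      ⟨.mark b, i, tape (List.replicate k 1 ++ List.replicate (s + 1) 2), 1, qt⟩
      ⟨.mark b, i - (k + s + 1), tape (List.replicate (k + 1) 1 ++ List.replicate s 2), 1, qt⟩ := by
  have h1 : searchProg.Reaches B w S k
      ⟨.mark b, i, tape (List.replicate k 1 ++ List.replicate (s + 1) 2), 1, qt⟩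
      ⟨.mark b, i, tape (List.replicate k 1 ++ List.replicate (s + 1) 2), k + 1, qt⟩ :=
      by
    apply Prog.Reaches.sweep_right (P := searchProg) (A := B) (x := w) (q := .mark b) id
      (fun _ => none) .stay ⟨nofun, nofun, nofun⟩ (List.replicate k 1) [] (List.replicate (s + 1) 2)
    · intro g hg c; obtain rfl := List.eq_of_mem_replicate hg; rfl
    · rfl
    · simp
    · simp
    · simp
    · simp [TMove.iterate_stay]
    · omega
    · simp
    · simp
  have h2 : searchProg.Reaches B w S 1
      ⟨.mark b, i, tape (List.replicate k 1 ++ List.replicate (s + 1) 2), k + 1, qt⟩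
      ⟨.sweep b, i, tape (List.replicate (k + 1) 1 ++ List.replicate s 2), k + 2, qt⟩ :=
    Prog.Reaches.step ⟨nofun, nofun, nofun⟩ (g := some 2)
      (by rw [List.replicate_succ, tape_middle]; simp) rfl
      (by rw [List.replicate_succ, update_tape_middle _ _ _ _ (by simp)]
          simp [List.replicate_succ', -List.replicate_append_replicate])
      rfl rfl (by omega) (by simp)
  have h3 : searchProg.Reaches B w S s
      ⟨.sweep b, i, tape (List.replicate (k + 1) 1 ++ List.replicate s 2), k + 2, qt⟩
      ⟨.sweep b, i - s, tape (List.replicate (k + 1) 1 ++ List.replicate s 2), k + s + 2, qt⟩ :=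
      by
    apply Prog.Reaches.sweep_right (P := searchProg) (A := B) (x := w) (q := .sweep b) id
      (fun _ => none) .left ⟨nofun, nofun, nofun⟩ (List.replicate s 2) (List.replicate (k + 1) 1) []
    · exact fun _ _ _ => rfl
    · simp
    · simp
    · simp
    · simp; omega
    · rw [TMove.iterate_left, List.length_replicate]
    · omega
    · simp
    · simp
  have h4 : searchProg.Reaches B w S 1
      ⟨.sweep b, i - s, tape (List.replicate (k + 1) 1 ++ List.replicate s 2), k + s + 2, qt⟩
      ⟨.back b, i - s, tape (List.replicate (k + 1) 1 ++ List.replicate s 2), k + s + 1, qt⟩ :=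
    Prog.Reaches.keep ⟨nofun, nofun, nofun⟩ (tape_end _ (by simp; omega)) rfl
      rfl rfl (by omega) (by simp)
  have h5 : searchProg.Reaches B w S s
      ⟨.back b, i - s, tape (List.replicate (k + 1) 1 ++ List.replicate s 2), k + s + 1, qt⟩
      ⟨.back b, i - s, tape (List.replicate (k + 1) 1 ++ List.replicate s 2), k + 1, qt⟩ :=
      by
    apply Prog.Reaches.sweep_left (P := searchProg) (A := B) (x := w) (q := .back b) id
      (fun _ => none) .stay ⟨nofun, nofun, nofun⟩ (List.replicate s 2) (List.replicate (k + 1) 1) []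
    · intro g hg c; obtain rfl := List.eq_of_mem_replicate hg; rfl
    · simp
    · simp
    · simp; omega
    · simp
    · simp [TMove.iterate_stay]
    · omega
    · simp
    · simp
  have h6 : searchProg.Reaches B w S (k + 1)
      ⟨.back b, i - s, tape (List.replicate (k + 1) 1 ++ List.replicate s 2), k + 1, qt⟩
      ⟨.back b, i - (k + s + 1), tape (List.replicate (k + 1) 1 ++ List.replicate s 2), 0, qt⟩ :=
      by
    apply Prog.Reaches.sweep_left (P := searchProg) (A := B) (x := w) (q := .back b) id
      (fun _ => none) .left ⟨nofun, nofun, nofun⟩ (List.replicate (k + 1) 1) []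
      (List.replicate s 2)
    · intro g hg c; obtain rfl := List.eq_of_mem_replicate hg; rfl
    · rfl
    · simp
    · simp
    · rfl
    · rw [TMove.iterate_left, List.length_replicate]; omega
    · omega
    · simp
    · simp
  have h7 : searchProg.Reaches B w S 1
      ⟨.back b, i - (k + s + 1), tape (List.replicate (k + 1) 1 ++ List.replicate s 2), 0, qt⟩
      ⟨.mark b, i - (k + s + 1), tape (List.replicate (k + 1) 1 ++ List.replicate s 2), 1, qt⟩ :=
    Prog.Reaches.keep ⟨nofun, nofun, nofun⟩ (tape_zero _) rfl
      rfl rfl (by omega) (by simp)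
  exact ((((((h1.trans h2).trans h3).trans h4).trans h5).trans h6).trans h7).mono
    (by simp; omega)

theorem searchProg_passes (b : Bool) (s k i : ℕ) (qt : List (Fin 3)) (hS : k + s + 1 ≤ S) :
    searchProg.Reaches B w S (s * (2 * (k + s) + 2))
      ⟨.mark b, i, tape (List.replicate k 1 ++ List.replicate s 2), 1, qt⟩
      ⟨.mark b, i - s * (k + s), tape (List.replicate (k + s) 1), 1, qt⟩ := by
  induction s generalizing k i with
  | zero => exact (by simpa using Prog.Reaches.refl _)
  | succ s ih =>
    have h := (searchProg_pass (B := B) (w := w) b k s i qt (by omega)).trans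
      (ih (k + 1) (i - (k + s + 1)) (by omega))
    have e : i - (k + s + 1) - s * (k + 1 + s) = i - (s + 1) * (k + (s + 1)) := by
      rw [Nat.sub_sub]; congr 1; ring
    rw [e, show k + 1 + s = k + (s + 1) by omega] at h
    exact h.mono (by ring_nf; omega)

theorem inputRead_ne_rend {Γ : Type} (x : List Γ) {i : ℕ} (h : i ≤ x.length) :
    inputRead x i ≠ .rend := by
  rcases i with _ | i
  · simp
  · simp [inputRead_succ x h]

theorem inputRead_ne_lend {Γ : Type} (x : List Γ) (i : ℕ) : inputRead x (i + 1) ≠ .lend := by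
  unfold inputRead
  rw [if_neg (Nat.succ_ne_zero i)]
  split <;> simp

theorem searchProg_toEnd (b : Bool) (W : ℕ → Option (Fin 3)) (qt : List (Fin 3)) (d i : ℕ)
    (hd : i + d = w.length + 1) :
    searchProg.Reaches B w S d ⟨.toEnd b, i, W, 0, qt⟩ ⟨.toEnd b, w.length + 1, W, 0, qt⟩ := by
  induction d generalizing i with
  | zero => obtain rfl : i = w.length + 1 := by omega
            exact Prog.Reaches.refl _
  | succ d ih =>
    have h : searchProg.Reaches B w S 1 ⟨.toEnd b, i, W, 0, qt⟩ ⟨.toEnd b, i + 1, W, 0, qt⟩ := by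
      refine Prog.Reaches.keep (mi := .right) (mw := .stay) (qw := none)
        ⟨nofun, nofun, nofun⟩ rfl ?_ rfl rfl (Nat.zero_le _) (by simp)
      have := inputRead_ne_rend w (i := i) (by omega)
      revert this
      cases inputRead w i <;> simp [searchProg]
    exact (h.trans (ih (i + 1) (by omega))).mono (by omega)

theorem searchProg_square (b : Bool) (r i : ℕ) (qt : List (Fin 3)) (hi : i ≤ w.length + 1)
    (hS : r + 1 ≤ S) :
    searchProg.Reaches B w S (w.length + 4 + 2 * r + r * (2 * r + 2))
      ⟨.toEnd b, i, tape (List.replicate r 2), 0, qt⟩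
      ⟨if b then .high1 else .low, w.length - r * r, tape (List.replicate r 2), 0, qt⟩ := by
  have h1 := searchProg_toEnd (B := B) (w := w) (S := S) b (tape (List.replicate r 2)) qt
    (w.length + 1 - i) i (by omega)
  have h2 : searchProg.Reaches B w S 1
      ⟨.toEnd b, w.length + 1, tape (List.replicate r 2), 0, qt⟩
      ⟨.mark b, w.length, tape (List.replicate r 2), 1, qt⟩ :=
    Prog.Reaches.keep ⟨nofun, nofun, nofun⟩ (tape_zero _)
      (by rw [inputRead_end]; rfl) rfl rfl (by omega) (by simp)
  have h3 := searchProg_passes (B := B) (w := w) b r 0 w.length qt (S := S) (by omega)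
  simp only [List.replicate_zero, List.nil_append, Nat.zero_add] at h3
  have h4 : searchProg.Reaches B w S r
      ⟨.mark b, w.length - r * r, tape (List.replicate r 1), 1, qt⟩
      ⟨.mark b, w.length - r * r, tape (List.replicate r 1), r + 1, qt⟩ :=
      by
    apply Prog.Reaches.sweep_right (P := searchProg) (A := B) (x := w) (q := .mark b) id
      (fun _ => none) .stay ⟨nofun, nofun, nofun⟩ (List.replicate r 1) [] []
    · intro g hg c; obtain rfl := List.eq_of_mem_replicate hg; rfl
    · simp
    · simp
    · simp
    · simp
    · simp [TMove.iterate_stay]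
    · omega
    · simp
    · simp
  have h5 : searchProg.Reaches B w S 1
      ⟨.mark b, w.length - r * r, tape (List.replicate r 1), r + 1, qt⟩
      ⟨.unmark b, w.length - r * r, tape (List.replicate r 1), r, qt⟩ :=
    Prog.Reaches.keep ⟨nofun, nofun, nofun⟩ (tape_end _ (by simp)) rfl
      rfl rfl (by omega) (by simp)
  have h6 : searchProg.Reaches B w S r
      ⟨.unmark b, w.length - r * r, tape (List.replicate r 1), r, qt⟩
      ⟨.unmark b, w.length - r * r, tape (List.replicate r 2), 0, qt⟩ :=
      by
    apply Prog.Reaches.sweep_left (P := searchProg) (A := B) (x := w) (q := .unmark b)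
      (fun _ => 2) (fun _ => none) .stay ⟨nofun, nofun, nofun⟩ (List.replicate r 1) [] []
    · exact fun _ _ _ => rfl
    · simp
    · simp
    · simp
    · rfl
    · simp [TMove.iterate_stay]
    · omega
    · simp
    · simp
  have h7 : searchProg.Reaches B w S 1
      ⟨.unmark b, w.length - r * r, tape (List.replicate r 2), 0, qt⟩
      ⟨if b then .high1 else .low, w.length - r * r, tape (List.replicate r 2), 0, qt⟩ :=
    Prog.Reaches.keep ⟨nofun, nofun, nofun⟩ (tape_zero _) rfl
      rfl rfl (by omega) (by simp)
  exact ((((((h1.trans h2).trans h3).trans h4).trans h5).trans h6).trans h7).mono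
    (by simp; omega)

theorem inputRead_of_getElem? {Γ : Type} {x : List Γ} {i : ℕ} {g : Γ} (h : x[i]? = some g) :
    inputRead x (i + 1) = .sym g := by
  simp [inputRead, h]

theorem searchProg_low_ones (W : ℕ → Option (Fin 3)) (qt : List (Fin 3)) (e d : ℕ)
    (h : ∀ k, e ≤ k → k < e + d → w[k]? = some 1) :
    searchProg.Reaches B w S d ⟨.low, e + d, W, 0, qt⟩ ⟨.low, e, W, 0, qt⟩ := by
  induction d with
  | zero => exact Prog.Reaches.refl _
  | succ d ih =>
    have h1 : searchProg.Reaches B w S 1 ⟨.low, e + d + 1, W, 0, qt⟩ ⟨.low, e + d, W, 0, qt⟩ :=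
      Prog.Reaches.keep (mi := .left) (mw := .stay) (qw := none) ⟨nofun, nofun, nofun⟩ rfl
        (by rw [inputRead_of_getElem? (h (e + d) (by omega) (by omega))]; rfl)
        rfl rfl (Nat.zero_le _) (by simp)
    exact (h1.trans (ih fun k h2 h3 => h k h2 (by omega))).mono (by omega)

theorem searchProg_low_ok (W : ℕ → Option (Fin 3)) (qt : List (Fin 3)) (d : ℕ)
    (h0 : w[0]? = some 1) (h1 : w[1]? = some 0)
    (h : ∀ k, 2 ≤ k → k < d → w[k]? = some 1) :
    searchProg.Reaches B w S (d + 1) ⟨.low, d, W, 0, qt⟩ ⟨.rewind, 0, W, 0, qt⟩ := by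
  have hz : searchProg.Reaches B w S 1 ⟨.low, 0, W, 0, qt⟩ ⟨.rewind, 0, W, 0, qt⟩ :=
    Prog.Reaches.keep (mi := .stay) (mw := .stay) (qw := none) ⟨nofun, nofun, nofun⟩ rfl
      rfl rfl rfl (Nat.zero_le _) (by simp)
  rcases lt_or_ge d 2 with hd | hd
  · have h2 := searchProg_low_ones (B := B) (S := S) W qt 0 d
      fun k _ hk => by obtain rfl : k = 0 := by omega
                       exact h0
    rw [Nat.zero_add] at h2
    exact h2.trans hz
  · obtain ⟨d, rfl⟩ := Nat.exists_eq_add_of_le hd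
    have h2 := searchProg_low_ones (B := B) (S := S) W qt 2 d h
    have h3 : searchProg.Reaches B w S 1 ⟨.low, 2, W, 0, qt⟩ ⟨.low2, 1, W, 0, qt⟩ :=
      Prog.Reaches.keep (mi := .left) (mw := .stay) (qw := none) ⟨nofun, nofun, nofun⟩ rfl
        (by rw [inputRead_of_getElem? h1]; rfl) rfl rfl (Nat.zero_le _) (by simp)
    have h4 : searchProg.Reaches B w S 1 ⟨.low2, 1, W, 0, qt⟩ ⟨.low3, 0, W, 0, qt⟩ :=
      Prog.Reaches.keep (mi := .left) (mw := .stay) (qw := none) ⟨nofun, nofun, nofun⟩ rfl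
        rfl rfl rfl (Nat.zero_le _) (by simp)
    have h5 : searchProg.Reaches B w S 1 ⟨.low3, 0, W, 0, qt⟩ ⟨.rewind, 0, W, 0, qt⟩ :=
      Prog.Reaches.keep (mi := .stay) (mw := .stay) (qw := none) ⟨nofun, nofun, nofun⟩ rfl
        rfl rfl rfl (Nat.zero_le _) (by simp)
    exact (((h2.trans h3).trans h4).trans h5).mono (by omega)

theorem searchProg_low_fail (W : ℕ → Option (Fin 3)) (qt : List (Fin 3)) (d : ℕ)
    (hd : d ≤ w.length) (h : ∃ k, 2 ≤ k ∧ k < d ∧ w[k]? ≠ some 1) :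
    ∃ i ≤ w.length, searchProg.Reaches B w S (d + 1) ⟨.low, d, W, 0, qt⟩ ⟨.ext, i, W, 0, qt⟩ := by
  induction d with
  | zero => obtain ⟨k, -, hk, -⟩ := h; omega
  | succ d ih =>
    have hr := inputRead_succ w hd
    by_cases hc : w[d] = 1
    · rw [hc] at hr
      obtain ⟨k, hk2, hk, hk1⟩ := h
      have hkd : k ≠ d := by
        rintro rfl
        exact hk1 (by rw [List.getElem?_eq_getElem hd, hc])
      obtain ⟨i, hi, h2⟩ := ih (by omega) ⟨k, hk2, by omega, hk1⟩
      have h1 : searchProg.Reaches B w S 1 ⟨.low, d + 1, W, 0, qt⟩ ⟨.low, d, W, 0, qt⟩ :=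
        Prog.Reaches.keep (mi := .left) (mw := .stay) (qw := none) ⟨nofun, nofun, nofun⟩ rfl
          (by rw [hr]; rfl) rfl rfl (Nat.zero_le _) (by simp)
      exact ⟨i, hi, (h1.trans h2).mono (by omega)⟩
    · obtain ⟨d, rfl⟩ : ∃ e, d = e + 2 := by
        obtain ⟨k, hk2, hk, -⟩ := h
        exact ⟨d - 2, by omega⟩
      have h1 : searchProg.Reaches B w S 1 ⟨.low, d + 3, W, 0, qt⟩ ⟨.low2, d + 2, W, 0, qt⟩ :=
        Prog.Reaches.keep (mi := .left) (mw := .stay) (qw := none) ⟨nofun, nofun, nofun⟩ rfl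
          (by rw [hr]; revert hc; generalize w[d + 2] = c
              fin_cases c <;> simp [searchProg]) rfl rfl (Nat.zero_le _) (by simp)
      have h2 : searchProg.Reaches B w S 1 ⟨.low2, d + 2, W, 0, qt⟩ ⟨.low3, d + 1, W, 0, qt⟩ :=
        Prog.Reaches.keep (mi := .left) (mw := .stay) (qw := none) ⟨nofun, nofun, nofun⟩ rfl
          rfl rfl rfl (Nat.zero_le _) (by simp)
      have h3 : searchProg.Reaches B w S 1 ⟨.low3, d + 1, W, 0, qt⟩ ⟨.ext, d + 1, W, 0, qt⟩ :=
        Prog.Reaches.keep (mi := .stay) (mw := .stay) (qw := none) ⟨nofun, nofun, nofun⟩ rfl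
          (by have := inputRead_ne_lend w d
              revert this
              cases inputRead w (d + 1) <;> simp [searchProg]) rfl rfl (Nat.zero_le _) (by simp)
      exact ⟨d + 1, by omega, ((h1.trans h2).trans h3).mono (by omega)⟩

theorem searchProg_high (W : ℕ → Option (Fin 3)) (qt : List (Fin 3)) (d : ℕ) :
    searchProg.Reaches B w S 4 ⟨.high1, d, W, 0, qt⟩
      ⟨if d ≤ 3 then .rej else .ext, d - 3, W, 0, qt⟩ := by
  have h1 : searchProg.Reaches B w S 1 ⟨.high1, d, W, 0, qt⟩ ⟨.high2, d - 1, W, 0, qt⟩ :=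
    Prog.Reaches.keep (mi := .left) (mw := .stay) (qw := none) ⟨nofun, nofun, nofun⟩ rfl
      rfl rfl rfl (Nat.zero_le _) (by simp)
  have h2 : searchProg.Reaches B w S 1 ⟨.high2, d - 1, W, 0, qt⟩ ⟨.high3, d - 2, W, 0, qt⟩ :=
    Prog.Reaches.keep (mi := .left) (mw := .stay) (qw := none) ⟨nofun, nofun, nofun⟩ rfl
      rfl rfl rfl (Nat.zero_le _) (by simp)
  have h3 : searchProg.Reaches B w S 1 ⟨.high3, d - 2, W, 0, qt⟩ ⟨.high4, d - 3, W, 0, qt⟩ :=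
    Prog.Reaches.keep (mi := .left) (mw := .stay) (qw := none) ⟨nofun, nofun, nofun⟩ rfl
      rfl rfl rfl (Nat.zero_le _) (by simp)
  have h4 : searchProg.Reaches B w S 1 ⟨.high4, d - 3, W, 0, qt⟩
      ⟨if d ≤ 3 then .rej else .ext, d - 3, W, 0, qt⟩ := by
    refine Prog.Reaches.keep (mi := .stay) (mw := .stay) (qw := none) ⟨nofun, nofun, nofun⟩ rfl
      ?_ rfl rfl (Nat.zero_le _) (by simp)
    split_ifs with hd
    · rw [Nat.sub_eq_zero_of_le hd]; rfl
    · obtain ⟨e, he⟩ : ∃ e, d - 3 = e + 1 := ⟨d - 4, by omega⟩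
      rw [he]
      have := inputRead_ne_lend w e
      revert this
      cases inputRead w (e + 1) <;> simp [searchProg]
  exact ((h1.trans h2).trans h3).trans h4

theorem searchProg_ext (r i : ℕ) (qt : List (Fin 3)) (hS : r + 1 ≤ S) :
    searchProg.Reaches B w S (2 * r + 3) ⟨.ext, i, tape (List.replicate r 2), 0, qt⟩
      ⟨.toEnd false, i, tape (List.replicate (r + 1) 2), 0, qt⟩ := by
  have h1 : searchProg.Reaches B w S 1 ⟨.ext, i, tape (List.replicate r 2), 0, qt⟩
      ⟨.ext1, i, tape (List.replicate r 2), 1, qt⟩ :=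
    Prog.Reaches.keep ⟨nofun, nofun, nofun⟩ (tape_zero _) rfl rfl rfl (by omega) (by simp)
  have h2 : searchProg.Reaches B w S r ⟨.ext1, i, tape (List.replicate r 2), 1, qt⟩
      ⟨.ext1, i, tape (List.replicate r 2), r + 1, qt⟩ := by
    apply Prog.Reaches.sweep_right (P := searchProg) (A := B) (x := w) (q := .ext1)
      id (fun _ => none) .stay ⟨nofun, nofun, nofun⟩ (List.replicate r 2) [] []
    · exact fun _ _ _ => rfl
    · simp
    · simp
    · simp
    · simp
    · simp [TMove.iterate_stay]
    · omega
    · simp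
    · simp
  have h3 : searchProg.Reaches B w S 1 ⟨.ext1, i, tape (List.replicate r 2), r + 1, qt⟩
      ⟨.ext2, i, tape (List.replicate (r + 1) 2), r, qt⟩ :=
    Prog.Reaches.step ⟨nofun, nofun, nofun⟩ (tape_end _ (by simp)) rfl
      (by rw [update_tape_end _ _ (by simp), List.replicate_succ']) rfl rfl (by omega) (by simp)
  have h4 : searchProg.Reaches B w S r ⟨.ext2, i, tape (List.replicate (r + 1) 2), r, qt⟩
      ⟨.ext2, i, tape (List.replicate (r + 1) 2), 0, qt⟩ := by
    apply Prog.Reaches.sweep_left (P := searchProg) (A := B) (x := w) (q := .ext2)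
      id (fun _ => none) .stay ⟨nofun, nofun, nofun⟩ (List.replicate r 2) [] [2]
    · exact fun _ _ _ => rfl
    · simp [List.replicate_succ']
    · simp [List.replicate_succ']
    · simp
    · rfl
    · simp [TMove.iterate_stay]
    · omega
    · simp
    · simp
  have h5 : searchProg.Reaches B w S 1 ⟨.ext2, i, tape (List.replicate (r + 1) 2), 0, qt⟩
      ⟨.toEnd false, i, tape (List.replicate (r + 1) 2), 0, qt⟩ :=
    Prog.Reaches.keep ⟨nofun, nofun, nofun⟩ (tape_zero _) rfl rfl rfl (by omega) (by simp)
  exact ((((h1.trans h2).trans h3).trans h4).trans h5).mono (by omega)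

theorem searchProg_rewind (W : ℕ → Option (Fin 3)) (qt : List (Fin 3)) (i : ℕ)
    (hi : i ≤ w.length + 1) :
    searchProg.Reaches B w S (i + 1) ⟨.rewind, i, W, 0, qt⟩ ⟨.copy, 1, W, 0, qt⟩ := by
  induction i with
  | zero =>
    exact Prog.Reaches.keep (mi := .right) (mw := .stay) (qw := none) ⟨nofun, nofun, nofun⟩ rfl
      rfl rfl rfl (Nat.zero_le _) (by simp)
  | succ i ih =>
    have h1 : searchProg.Reaches B w S 1 ⟨.rewind, i + 1, W, 0, qt⟩ ⟨.rewind, i, W, 0, qt⟩ := by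
      refine Prog.Reaches.keep (mi := .left) (mw := .stay) (qw := none) ⟨nofun, nofun, nofun⟩ rfl
        ?_ rfl rfl (Nat.zero_le _) (by simp)
      have := inputRead_ne_lend w i
      revert this
      cases inputRead w (i + 1) <;> simp [searchProg]
    exact (h1.trans (ih (by omega))).mono (by omega)

theorem searchProg_copy (W : ℕ → Option (Fin 3)) (b a qt : List (Fin 3)) (hS : 1 ≤ S) :
    searchProg.Reaches B (a ++ b) S (b.length + 1) ⟨.copy, a.length + 1, W, 0, qt⟩
      ⟨.find, (a ++ b).length + 1, W, 1, qt ++ (b ++ [2])⟩ := by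
  induction b generalizing a qt with
  | nil =>
    have h1 : searchProg.Reaches B (a ++ []) S 1 ⟨.copy, a.length + 1, W, 0, qt⟩
        ⟨.find, a.length + 1, W, 1, qt ++ [2]⟩ :=
      Prog.Reaches.keep (mi := .stay) (mw := .right) (qw := some 2) ⟨nofun, nofun, nofun⟩ rfl
        (by rw [List.append_nil, inputRead_end]; rfl) rfl rfl hS rfl
    simpa using h1
  | cons g b ih =>
    have h1 : searchProg.Reaches B (a ++ g :: b) S 1 ⟨.copy, a.length + 1, W, 0, qt⟩
        ⟨.copy, a.length + 1 + 1, W, 0, qt ++ [g]⟩ :=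
      Prog.Reaches.keep (mi := .right) (mw := .stay) (qw := some g) ⟨nofun, nofun, nofun⟩ rfl
        (by rw [inputRead_append]; rfl) rfl rfl (Nat.zero_le _) rfl
    have h2 := ih (a ++ [g]) (qt ++ [g])
    refine Prog.Reaches.mono (T := 1 + (b.length + 1)) (h1.trans ?_) (by simp [Nat.add_comm])
    simpa using h2

/-- Rewinding the input head and copying the input with a separator to the query tape. -/
theorem searchProg_load (W : ℕ → Option (Fin 3)) (i : ℕ) (hi : i ≤ w.length + 1) (hS : 1 ≤ S) :
    searchProg.Reaches B w S (2 * w.length + 3) ⟨.rewind, i, W, 0, []⟩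
      ⟨.find, w.length + 1, W, 1, w ++ [2]⟩ :=
  ((searchProg_rewind W [] i hi).trans (searchProg_copy W w [] [] hS)).mono (by omega)

/-- The oracle's answer to the query about the binary word `1 0^(r-j) 1^j` on input `w`. -/
noncomputable def answer (B : Set (List (Fin 3))) (w : List (Fin 3)) (r j : ℕ) : Fin 3 :=
  if w ++ 2 :: 0 :: 1 :: (List.replicate (r - j) 0 ++ List.replicate j 1) ∈ B then 1 else 0

/-- The word formed by the first `m` answers. -/
noncomputable def answers (B : Set (List (Fin 3))) (w : List (Fin 3)) (r m : ℕ) : List (Fin 3) :=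
  (List.range m).map fun j => answer B w r (j + 1)

theorem length_answers (r m : ℕ) : (answers B w r m).length = m := by simp [answers]

theorem answers_succ (r m : ℕ) :
    answers B w r (m + 1) = answers B w r m ++ [answer B w r (m + 1)] := by
  simp [answers, List.range_succ]

theorem ne_two_of_mem_answers {r m : ℕ} {g : Fin 3} (h : g ∈ answers B w r m) : g ≠ 2 := by
  obtain ⟨j, -, rfl⟩ := List.mem_map.1 h
  unfold answer
  split_ifs <;> decide

theorem searchProg_find (a b Z : List (Fin 3)) (i : ℕ) (ha : ∀ g ∈ a, g ≠ 2)
    (hS : a.length + 1 ≤ S) :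
    searchProg.Reaches B w S a.length ⟨.find, i, tape (a ++ b), 1, Z⟩
      ⟨.find, i, tape (a ++ b), a.length + 1, Z⟩ := by
  apply Prog.Reaches.sweep_right (P := searchProg) (A := B) (x := w) (q := .find)
    id (fun _ => none) .stay ⟨nofun, nofun, nofun⟩ a [] b
  · intro g hg c
    have := ha g hg
    revert this
    fin_cases g <;> simp [searchProg]
  · rfl
  · simp
  · simp
  · simp
  · simp [TMove.iterate_stay]
  · omega
  · simp
  · simp

theorem searchProg_ask (a Z : List (Fin 3)) (s i : ℕ) (ha : ∀ g ∈ a, g ≠ 2)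
    (hS : a.length + s + 2 ≤ S) :
    searchProg.Reaches B w S (2 * (a.length + s) + 5)
      ⟨.find, i, tape (a ++ List.replicate (s + 1) 2), 1, Z⟩
      ⟨.ask, i, tape (a ++ List.replicate (s + 1) 2), 0,
        Z ++ 0 :: 1 :: (List.replicate s 0 ++ List.replicate (a.length + 1) 1)⟩ := by
  have h1 := searchProg_find (B := B) (w := w) (S := S) a (List.replicate (s + 1) 2) Z i ha
    (by omega)
  have h2 : searchProg.Reaches B w S 1
      ⟨.find, i, tape (a ++ List.replicate (s + 1) 2), a.length + 1, Z⟩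
      ⟨.sep, i, tape (a ++ List.replicate (s + 1) 2), a.length + 1, Z ++ [0]⟩ :=
    Prog.Reaches.keep ⟨nofun, nofun, nofun⟩ (g := some 2)
      (by rw [List.replicate_succ, tape_middle _ _ _ rfl]) rfl rfl rfl (by omega) rfl
  have h3 : searchProg.Reaches B w S 1
      ⟨.sep, i, tape (a ++ List.replicate (s + 1) 2), a.length + 1, Z ++ [0]⟩
      ⟨.zeros, i, tape (a ++ List.replicate (s + 1) 2), a.length + 2, Z ++ [0, 1]⟩ :=
    Prog.Reaches.keep ⟨nofun, nofun, nofun⟩ rfl rfl rfl rfl (by omega) (by simp)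
  have h4 : searchProg.Reaches B w S s
      ⟨.zeros, i, tape (a ++ List.replicate (s + 1) 2), a.length + 2, Z ++ [0, 1]⟩
      ⟨.zeros, i, tape (a ++ List.replicate (s + 1) 2), a.length + s + 2,
        Z ++ 0 :: 1 :: List.replicate s 0⟩ := by
    apply Prog.Reaches.sweep_right (P := searchProg) (A := B) (x := w) (q := .zeros)
      id (fun _ => some 0) .stay ⟨nofun, nofun, nofun⟩ (List.replicate s 2) (a ++ [2]) []
    · exact fun _ _ _ => rfl
    · simp [List.replicate_succ]
    · simp [List.replicate_succ]
    · simp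
    · simp; omega
    · simp [TMove.iterate_stay]
    · omega
    · simp
    · simp
  have h5 : searchProg.Reaches B w S 1
      ⟨.zeros, i, tape (a ++ List.replicate (s + 1) 2), a.length + s + 2,
        Z ++ 0 :: 1 :: List.replicate s 0⟩
      ⟨.ones, i, tape (a ++ List.replicate (s + 1) 2), a.length + s + 1,
        Z ++ 0 :: 1 :: (List.replicate s 0 ++ [1])⟩ :=
    Prog.Reaches.keep ⟨nofun, nofun, nofun⟩ (tape_end _ (by simp; omega)) rfl rfl rfl (by omega)
      (by simp)
  have h6 : searchProg.Reaches B w S (s + 1)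
      ⟨.ones, i, tape (a ++ List.replicate (s + 1) 2), a.length + s + 1,
        Z ++ 0 :: 1 :: (List.replicate s 0 ++ [1])⟩
      ⟨.ones, i, tape (a ++ List.replicate (s + 1) 2), a.length,
        Z ++ 0 :: 1 :: (List.replicate s 0 ++ [1])⟩ := by
    apply Prog.Reaches.sweep_left (P := searchProg) (A := B) (x := w) (q := .ones)
      id (fun _ => none) .stay ⟨nofun, nofun, nofun⟩ (List.replicate (s + 1) 2) a []
    · intro g hg c; obtain rfl := List.eq_of_mem_replicate hg; rfl
    · simp
    · simp
    · simp; omega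
    · simp
    · simp [TMove.iterate_stay]
    · omega
    · simp
    · simp
  have h7 : searchProg.Reaches B w S a.length
      ⟨.ones, i, tape (a ++ List.replicate (s + 1) 2), a.length,
        Z ++ 0 :: 1 :: (List.replicate s 0 ++ [1])⟩
      ⟨.ones, i, tape (a ++ List.replicate (s + 1) 2), 0,
        Z ++ 0 :: 1 :: (List.replicate s 0 ++ List.replicate (a.length + 1) 1)⟩ := by
    apply Prog.Reaches.sweep_left (P := searchProg) (A := B) (x := w) (q := .ones)
      id (fun _ => some 1) .stay ⟨nofun, nofun, nofun⟩ a [] (List.replicate (s + 1) 2)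
    · intro g hg c
      have := ha g hg
      revert this
      fin_cases g <;> simp [searchProg]
    · rfl
    · simp
    · simp
    · simp
    · simp [TMove.iterate_stay]
    · omega
    · simp [List.replicate_succ]
    · simp
  have h8 : searchProg.Reaches B w S 1
      ⟨.ones, i, tape (a ++ List.replicate (s + 1) 2), 0,
        Z ++ 0 :: 1 :: (List.replicate s 0 ++ List.replicate (a.length + 1) 1)⟩
      ⟨.ask, i, tape (a ++ List.replicate (s + 1) 2), 0,
        Z ++ 0 :: 1 :: (List.replicate s 0 ++ List.replicate (a.length + 1) 1)⟩ :=
    Prog.Reaches.keep ⟨nofun, nofun, nofun⟩ (tape_zero _) rfl rfl rfl (by omega) (by simp)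
  exact (((((((h1.trans h2).trans h3).trans h4).trans h5).trans h6).trans h7).trans h8).mono
    (by omega)

theorem searchProg_ret (a b : List (Fin 3)) (i : ℕ) (hS : a.length ≤ S) :
    searchProg.Reaches B w S (a.length + 1) ⟨.ret, i, tape (a ++ b), a.length, []⟩
      ⟨.rewind, i, tape (a ++ b), 0, []⟩ := by
  have h1 : searchProg.Reaches B w S a.length ⟨.ret, i, tape (a ++ b), a.length, []⟩
      ⟨.ret, i, tape (a ++ b), 0, []⟩ := by
    apply Prog.Reaches.sweep_left (P := searchProg) (A := B) (x := w) (q := .ret)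
      id (fun _ => none) .stay ⟨nofun, nofun, nofun⟩ a [] b
    · exact fun _ _ _ => rfl
    · simp
    · simp
    · simp
    · rfl
    · simp [TMove.iterate_stay]
    · omega
    · simp
    · simp
  exact h1.trans (Prog.Reaches.keep ⟨nofun, nofun, nofun⟩ (tape_zero _) rfl rfl rfl (by omega)
    (by simp))

/-- Skipping the known bits after a positive answer. -/
theorem searchProg_yes (a b : List (Fin 3)) (i : ℕ) (ha : ∀ g ∈ a, g ≠ 2)
    (hS : a.length + 1 ≤ S) :
    searchProg.Reaches B w S (a.length + 1) ⟨.yes, i, tape (a ++ b), 0, []⟩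
      ⟨.yes1, i, tape (a ++ b), a.length + 1, []⟩ := by
  have h1 : searchProg.Reaches B w S 1 ⟨.yes, i, tape (a ++ b), 0, []⟩
      ⟨.yes1, i, tape (a ++ b), 1, []⟩ :=
    Prog.Reaches.keep ⟨nofun, nofun, nofun⟩ (tape_zero _) rfl rfl rfl (by omega) (by simp)
  have h2 : searchProg.Reaches B w S a.length ⟨.yes1, i, tape (a ++ b), 1, []⟩
      ⟨.yes1, i, tape (a ++ b), a.length + 1, []⟩ := by
    apply Prog.Reaches.sweep_right (P := searchProg) (A := B) (x := w) (q := .yes1)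
      id (fun _ => none) .stay ⟨nofun, nofun, nofun⟩ a [] b
    · intro g hg c
      have := ha g hg
      revert this
      fin_cases g <;> simp [searchProg]
    · rfl
    · simp
    · simp
    · simp
    · simp [TMove.iterate_stay]
    · omega
    · simp
    · simp
  exact (h1.trans h2).mono (by omega)

/-- Skipping the known bits after a negative answer. -/
theorem searchProg_no (a b : List (Fin 3)) (i : ℕ) (ha : ∀ g ∈ a, g ≠ 2)
    (hS : a.length + 1 ≤ S) :
    searchProg.Reaches B w S (a.length + 1) ⟨.no, i, tape (a ++ b), 0, []⟩
      ⟨.no1, i, tape (a ++ b), a.length + 1, []⟩ := by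
  have h1 : searchProg.Reaches B w S 1 ⟨.no, i, tape (a ++ b), 0, []⟩
      ⟨.no1, i, tape (a ++ b), 1, []⟩ :=
    Prog.Reaches.keep ⟨nofun, nofun, nofun⟩ (tape_zero _) rfl rfl rfl (by omega) (by simp)
  have h2 : searchProg.Reaches B w S a.length ⟨.no1, i, tape (a ++ b), 1, []⟩
      ⟨.no1, i, tape (a ++ b), a.length + 1, []⟩ := by
    apply Prog.Reaches.sweep_right (P := searchProg) (A := B) (x := w) (q := .no1)
      id (fun _ => none) .stay ⟨nofun, nofun, nofun⟩ a [] b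
    · intro g hg c
      have := ha g hg
      revert this
      fin_cases g <;> simp [searchProg]
    · rfl
    · simp
    · simp
    · simp
    · simp [TMove.iterate_stay]
    · omega
    · simp
    · simp
  exact (h1.trans h2).mono (by omega)

theorem searchProg_round (r m i : ℕ) (hm : m < r) (hi : i ≤ w.length + 1) (hS : r + 1 ≤ S) :
    searchProg.Reaches B w S (2 * w.length + 4 * r + 12)
      ⟨.rewind, i, tape (answers B w r m ++ List.replicate (r - m) 2), 0, []⟩
      ⟨.rewind, w.length + 1,
        tape (answers B w r (m + 1) ++ List.replicate (r - (m + 1)) 2), 0, []⟩ := by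
  obtain ⟨s, rfl⟩ := Nat.exists_eq_add_of_lt hm
  rw [show m + s + 1 - m = s + 1 by omega, show m + s + 1 - (m + 1) = s by omega, answers_succ]
  set a := answers B w (m + s + 1) m with ha
  have hl : a.length = m := length_answers _ _
  have ha2 : ∀ g ∈ a, g ≠ 2 := fun g hg => ne_two_of_mem_answers hg
  have h1 := searchProg_load (B := B) (S := S) (tape (a ++ List.replicate (s + 1) 2)) i hi
    (by omega)
  have h2 := searchProg_ask (B := B) (w := w) (S := S) a (w ++ [2]) s (w.length + 1) ha2 (by omega)
  have h3 := Prog.Reaches.query (P := searchProg) (A := B) (x := w) (S := S) (i := w.length + 1)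
    (p := 0) (W := tape (a ++ List.replicate (s + 1) 2))
    (qt := w ++ [2] ++ 0 :: 1 :: (List.replicate s 0 ++ List.replicate (a.length + 1) 1))
    nofun nofun
  have he : answer B w (m + s + 1) (m + 1) =
      if w ++ [2] ++ 0 :: 1 :: (List.replicate s 0 ++ List.replicate (a.length + 1) 1) ∈ B
        then 1 else 0 := by
    unfold answer
    rw [show m + s + 1 - (m + 1) = s by omega, hl]
    simp
  have h4 := searchProg_ret (B := B) (w := w) (S := S) a
    (answer B w (m + s + 1) (m + 1) :: List.replicate s 2) (w.length + 1) (by omega)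
  refine Prog.Reaches.mono ((((h1.trans h2).trans h3).trans ?_).trans
    (by simpa using h4)) (T := 2 * w.length + 3 + (2 * (a.length + s) + 5) + 1 + (m + 2)
      + (a.length + 1)) (by omega)
  rw [he]
  split_ifs with hB
  · refine Prog.Reaches.trans (T := m + 1) (T' := 1)
      (hl ▸ searchProg_yes a _ _ ha2 (by omega)) ?_
    exact Prog.Reaches.step ⟨nofun, nofun, nofun⟩ (g := some 2)
      (by rw [List.replicate_succ, tape_middle _ _ _ (by rw [hl])]) rfl
      (by rw [List.replicate_succ, update_tape_middle _ _ _ _ (by rw [hl])]) rfl hl.symm (by omega)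
      (by simp)
  · refine Prog.Reaches.trans (T := m + 1) (T' := 1)
      (hl ▸ searchProg_no a _ _ ha2 (by omega)) ?_
    exact Prog.Reaches.step ⟨nofun, nofun, nofun⟩ (g := some 2)
      (by rw [List.replicate_succ, tape_middle _ _ _ (by rw [hl])]) rfl
      (by rw [List.replicate_succ, update_tape_middle _ _ _ _ (by rw [hl])]) rfl hl.symm (by omega)
      (by simp)

theorem searchProg_rounds (r m i : ℕ) (hm : m ≤ r) (hi : i ≤ w.length + 1) (hS : r + 1 ≤ S) :
    ∃ i' ≤ w.length + 1, searchProg.Reaches B w S (m * (2 * w.length + 4 * r + 12))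
      ⟨.rewind, i, tape (List.replicate r 2), 0, []⟩
      ⟨.rewind, i', tape (answers B w r m ++ List.replicate (r - m) 2), 0, []⟩ := by
  induction m with
  | zero => exact ⟨i, hi, (by simpa [answers] using Prog.Reaches.refl _)⟩
  | succ m ih =>
    obtain ⟨i', hi', h⟩ := ih (by omega)
    exact ⟨_, le_rfl, (h.trans (searchProg_round r m i' hm hi' hS)).mono (by ring_nf; omega)⟩

theorem searchProg_final (a Z : List (Fin 3)) (i : ℕ) (ha : ∀ g ∈ a, g ≠ 2)
    (hS : a.length + 1 ≤ S) :
    searchProg.Reaches B w S (4 * a.length + 4) ⟨.find, i, tape a, 1, Z⟩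
      ⟨.ask, i, tape a, 0, Z ++ 1 :: a⟩ := by
  have h1 := searchProg_find (B := B) (w := w) (S := S) a [] Z i ha (by omega)
  rw [List.append_nil] at h1
  have h2 : searchProg.Reaches B w S 1 ⟨.find, i, tape a, a.length + 1, Z⟩
      ⟨.final, i, tape a, a.length, Z ++ [1]⟩ :=
    Prog.Reaches.keep ⟨nofun, nofun, nofun⟩ (tape_end _ rfl) rfl rfl rfl (by omega) rfl
  have h3 : searchProg.Reaches B w S a.length ⟨.final, i, tape a, a.length, Z ++ [1]⟩
      ⟨.final, i, tape a, 0, Z ++ [1]⟩ := by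
    apply Prog.Reaches.sweep_left (P := searchProg) (A := B) (x := w) (q := .final)
      id (fun _ => none) .stay ⟨nofun, nofun, nofun⟩ a [] []
    · exact fun _ _ _ => rfl
    · simp
    · simp
    · simp
    · rfl
    · simp [TMove.iterate_stay]
    · omega
    · simp
    · simp
  have h4 : searchProg.Reaches B w S 1 ⟨.final, i, tape a, 0, Z ++ [1]⟩
      ⟨.emit, i, tape a, 1, Z ++ [1]⟩ :=
    Prog.Reaches.keep ⟨nofun, nofun, nofun⟩ (tape_zero _) rfl rfl rfl (by omega) (by simp)
  have h5 : searchProg.Reaches B w S a.length ⟨.emit, i, tape a, 1, Z ++ [1]⟩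
      ⟨.emit, i, tape a, a.length + 1, Z ++ 1 :: a⟩ := by
    apply Prog.Reaches.sweep_right (P := searchProg) (A := B) (x := w) (q := .emit)
      id some .stay ⟨nofun, nofun, nofun⟩ a [] []
    · exact fun _ _ _ => rfl
    · simp
    · simp
    · simp
    · simp
    · simp [TMove.iterate_stay]
    · omega
    · simp
    · simp
  have h6 : searchProg.Reaches B w S 1 ⟨.emit, i, tape a, a.length + 1, Z ++ 1 :: a⟩
      ⟨.final2, i, tape a, a.length, Z ++ 1 :: a⟩ :=
    Prog.Reaches.keep ⟨nofun, nofun, nofun⟩ (tape_end _ rfl) rfl rfl rfl (by omega) (by simp)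
  have h7 : searchProg.Reaches B w S a.length ⟨.final2, i, tape a, a.length, Z ++ 1 :: a⟩
      ⟨.final2, i, tape a, 0, Z ++ 1 :: a⟩ := by
    apply Prog.Reaches.sweep_left (P := searchProg) (A := B) (x := w) (q := .final2)
      id (fun _ => none) .stay ⟨nofun, nofun, nofun⟩ a [] []
    · exact fun _ _ _ => rfl
    · simp
    · simp
    · simp
    · rfl
    · simp [TMove.iterate_stay]
    · omega
    · simp
    · simp
  have h8 : searchProg.Reaches B w S 1 ⟨.final2, i, tape a, 0, Z ++ 1 :: a⟩
      ⟨.ask, i, tape a, 0, Z ++ 1 :: a⟩ :=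
    Prog.Reaches.keep ⟨nofun, nofun, nofun⟩ (tape_zero _) rfl rfl rfl (by omega) (by simp)
  exact (((((((h1.trans h2).trans h3).trans h4).trans h5).trans h6).trans h7).trans h8).mono
    (by omega)

/-- The final query and its evaluation, once all bits are known. -/
theorem searchProg_decide (r i : ℕ) (hi : i ≤ w.length + 1) (hS : r + 1 ≤ S) :
    searchProg.Reaches B w S (2 * w.length + 6 * r + 12)
      ⟨.rewind, i, tape (answers B w r r), 0, []⟩
      (if w ++ 2 :: 1 :: answers B w r r ∈ B
        then ⟨.acc, w.length + 1, tape (answers B w r r), r + 1, []⟩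
        else ⟨.toEnd true, w.length + 1, tape (List.replicate r 2), 0, []⟩) := by
  set a := answers B w r r with ha
  have hl : a.length = r := length_answers _ _
  have ha2 : ∀ g ∈ a, g ≠ 2 := fun g hg => ne_two_of_mem_answers hg
  have h1 := searchProg_load (B := B) (S := S) (tape a) i hi (by omega)
  have h2 := searchProg_final (B := B) (w := w) (S := S) a (w ++ [2]) (w.length + 1) ha2 (by omega)
  have h3 := Prog.Reaches.query (P := searchProg) (A := B) (x := w) (S := S) (i := w.length + 1)
    (p := 0) (W := tape a) (qt := w ++ [2] ++ 1 :: a) nofun nofun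
  rw [show w ++ [2] ++ 1 :: a = w ++ 2 :: 1 :: a by simp] at h2 h3
  refine Prog.Reaches.mono (((h1.trans h2).trans h3).trans ?_) (T := 2 * w.length + 3 +
    (4 * a.length + 4) + 1 + (2 * r + 3)) (by omega)
  split_ifs with hB
  · have h4 := searchProg_yes (B := B) (w := w) (S := S) a [] (w.length + 1) ha2 (by omega)
    rw [List.append_nil, hl] at h4
    refine Prog.Reaches.mono (h4.trans (T' := 1) ?_) (by omega)
    exact Prog.Reaches.keep ⟨nofun, nofun, nofun⟩ (tape_end _ (by rw [hl])) rfl rfl rfl (by omega)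
      (by simp)
  · have h4 := searchProg_no (B := B) (w := w) (S := S) a [] (w.length + 1) ha2 (by omega)
    rw [List.append_nil, hl] at h4
    have h5 : searchProg.Reaches B w S 1 ⟨.no1, w.length + 1, tape a, r + 1, []⟩
        ⟨.clear, w.length + 1, tape a, r, []⟩ :=
      Prog.Reaches.keep ⟨nofun, nofun, nofun⟩ (tape_end _ (by rw [hl])) rfl rfl rfl (by omega)
        (by simp)
    have h6 : searchProg.Reaches B w S r ⟨.clear, w.length + 1, tape a, r, []⟩
        ⟨.clear, w.length + 1, tape (List.replicate r 2), 0, []⟩ := by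
      apply Prog.Reaches.sweep_left (P := searchProg) (A := B) (x := w) (q := .clear)
        (fun _ => 2) (fun _ => none) .stay ⟨nofun, nofun, nofun⟩ a [] []
      · exact fun _ _ _ => rfl
      · simp
      · simp [hl]
      · simp [hl]
      · rfl
      · simp [TMove.iterate_stay]
      · omega
      · simp
      · simp [hl]
    have h7 : searchProg.Reaches B w S 1 ⟨.clear, w.length + 1, tape (List.replicate r 2), 0, []⟩
        ⟨.toEnd true, w.length + 1, tape (List.replicate r 2), 0, []⟩ :=
      Prog.Reaches.keep ⟨nofun, nofun, nofun⟩ (tape_zero _) rfl rfl rfl (by omega) (by simp)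
    exact (((h4.trans h5).trans h6).trans h7).mono (by omega)

/-- The test passed by `r` if the last `r²` symbols of `w` contain the part after `10 1^i`. -/
def LowOk (w : List (Fin 3)) (r : ℕ) : Prop :=
  ∀ k, 2 ≤ k → k < w.length - r * r → w[k]? = some 1

/-- The outcome of the final query for the parameter `r`. -/
def Found (B : Set (List (Fin 3))) (w : List (Fin 3)) (r : ℕ) : Prop :=
  LowOk w r ∧ w ++ 2 :: 1 :: answers B w r r ∈ B

/-- A bound on the time spent on one value of `r`, for `r ≤ R` and inputs of length `n`. -/
def iterTime (n R : ℕ) : ℕ := 10 * (n + R + 2) ^ 2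

theorem searchProg_next {r i R : ℕ} (hr : r ≤ R) (hi : i ≤ w.length + 1)
    (hS : R + 1 ≤ S) (h0 : w[0]? = some 1) (h1 : w[1]? = some 0) :
    (Found B w r ∧ ∃ s, s.state = .acc ∧ searchProg.Reaches B w S (iterTime w.length R)
      ⟨.toEnd false, i, tape (List.replicate r 2), 0, []⟩ s) ∨
    (¬ Found B w r ∧ LowOk w r ∧ w.length - r * r ≤ 3 ∧ ∃ s, s.state = .rej ∧
      searchProg.Reaches B w S (iterTime w.length R)
        ⟨.toEnd false, i, tape (List.replicate r 2), 0, []⟩ s) ∨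
    (¬ Found B w r ∧ (LowOk w r → 3 < w.length - r * r) ∧ ∃ i' ≤ w.length + 1,
      searchProg.Reaches B w S (iterTime w.length R)
        ⟨.toEnd false, i, tape (List.replicate r 2), 0, []⟩
        ⟨.toEnd false, i', tape (List.replicate (r + 1) 2), 0, []⟩) := by
  have hsq := searchProg_square (B := B) (w := w) (S := S) false r i [] hi (by omega)
  simp only [Bool.false_eq_true, if_false] at hsq
  have htime : w.length + 4 + 2 * r + r * (2 * r + 2) + (w.length + 1) +
      r * (2 * w.length + 4 * r + 12) + (2 * w.length + 6 * r + 12) +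
      (w.length + 4 + 2 * r + r * (2 * r + 2)) + 4 + (2 * r + 3) ≤ iterTime w.length R := by
    unfold iterTime
    generalize w.length = n
    obtain ⟨s, rfl⟩ := Nat.exists_eq_add_of_le hr
    nlinarith [Nat.zero_le (n * r), Nat.zero_le (n * s), Nat.zero_le (r * s)]
  have hd : w.length - r * r ≤ w.length := Nat.sub_le _ _
  by_cases hlow : LowOk w r
  · have hl := searchProg_low_ok (B := B) (S := S) (tape (List.replicate r 2)) [] _ h0 h1 hlow
    obtain ⟨i', hi', hrounds⟩ := searchProg_rounds (B := B) (w := w) (S := S) r r 0 le_rfl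
      (Nat.zero_le _) (by omega)
    rw [Nat.sub_self, List.replicate_zero, List.append_nil] at hrounds
    have hdec := searchProg_decide (B := B) (w := w) (S := S) r i' hi' (by omega)
    have hall := ((hsq.trans hl).trans hrounds).trans hdec
    by_cases hB : w ++ 2 :: 1 :: answers B w r r ∈ B
    · rw [if_pos hB] at hall
      exact .inl ⟨⟨hlow, hB⟩, _, rfl, hall.mono (by omega)⟩
    · rw [if_neg hB] at hall
      have hsq' := searchProg_square (B := B) (w := w) (S := S) true r (w.length + 1) [] le_rfl
        (by omega)
      have hhigh := searchProg_high (B := B) (w := w) (S := S) (tape (List.replicate r 2)) []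
        (w.length - r * r)
      have hall' := (hall.trans hsq').trans hhigh
      by_cases hd3 : w.length - r * r ≤ 3
      · rw [if_pos hd3] at hall'
        exact .inr (.inl ⟨fun h => hB h.2, hlow, hd3, _, rfl, hall'.mono (by omega)⟩)
      · rw [if_neg hd3] at hall'
        have hext := searchProg_ext (B := B) (w := w) (S := S) r (w.length - r * r - 3) []
          (by omega)
        exact .inr (.inr ⟨fun h => hB h.2, fun _ => by omega, _, by omega,
          (hall'.trans hext).mono (by omega)⟩)
  · have hf : ∃ k, 2 ≤ k ∧ k < w.length - r * r ∧ w[k]? ≠ some 1 := by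
      simpa [LowOk] using hlow
    obtain ⟨i', hi', hl⟩ := searchProg_low_fail (B := B) (S := S) (tape (List.replicate r 2)) [] _
      hd hf
    have hext := searchProg_ext (B := B) (w := w) (S := S) r i' [] (by omega)
    exact .inr (.inr ⟨fun h => hlow h.1, fun h => absurd h hlow, i', by omega,
      ((hsq.trans hl).trans hext).mono (by omega)⟩)

theorem searchProg_loop {f r i : ℕ} (hf : w.length ≤ (r + f) * (r + f) + 3) (hi : i ≤ w.length + 1)
    (hS : r + f + 1 ≤ S) (h0 : w[0]? = some 1) (h1 : w[1]? = some 0) (h2 : w[2]? = some 1) :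
    ∃ s, searchProg.Reaches B w S ((f + 1) * iterTime w.length (r + f))
        ⟨.toEnd false, i, tape (List.replicate r 2), 0, []⟩ s ∧
      (s.state = .acc ∨ s.state = .rej) ∧
      (s.state = .acc ↔ ∃ r' ≥ r, Found B w r' ∧ ∀ k, r ≤ k → k < r' → 3 < w.length - k * k) := by
  have hlow : ∀ r, w.length - r * r ≤ 3 → LowOk w r := fun r hr k hk2 hk => by
    obtain rfl : k = 2 := by omega
    exact h2
  induction f generalizing r i with
  | zero =>
    obtain ⟨hF, s, hs, h⟩ | ⟨hF, -, hd, s, hs, h⟩ | ⟨hF, hd, -⟩ :=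
      searchProg_next (B := B) (r := r) (R := r) le_rfl hi hS h0 h1
    · exact ⟨s, by simpa using h, .inl hs, iff_of_true hs ⟨r, le_rfl, hF, by omega⟩⟩
    · refine ⟨s, by simpa using h, .inr hs, iff_of_false (by rw [hs]; nofun) ?_⟩
      rintro ⟨r', hr', hF', hk⟩
      obtain rfl | hlt := hr'.eq_or_lt
      · exact hF hF'
      · have := hk r le_rfl hlt
        omega
    · have hd' : w.length - r * r ≤ 3 := by simp only [Nat.add_zero] at hf; omega
      have := hd (hlow r hd')
      omega
  | succ f ih =>
    obtain ⟨hF, s, hs, h⟩ | ⟨hF, -, hd, s, hs, h⟩ | ⟨hF, hd, i', hi', h⟩ :=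
      searchProg_next (B := B) (r := r) (R := r + (f + 1)) (by omega) hi hS h0 h1
    · exact ⟨s, h.mono (Nat.le_mul_of_pos_left _ (Nat.succ_pos _)), .inl hs,
        iff_of_true hs ⟨r, le_rfl, hF, by omega⟩⟩
    · refine ⟨s, h.mono (Nat.le_mul_of_pos_left _ (Nat.succ_pos _)), .inr hs,
        iff_of_false (by rw [hs]; nofun) ?_⟩
      rintro ⟨r', hr', hF', hk⟩
      obtain rfl | hlt := hr'.eq_or_lt
      · exact hF hF'
      · have := hk r le_rfl hlt
        omega
    · have e : r + 1 + f = r + (f + 1) := by omega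
      obtain ⟨s, hs, hh, hiff⟩ := ih (r := r + 1) (i := i') (by rwa [e]) hi' (by omega)
      rw [e] at hs
      refine ⟨s, (h.trans hs).mono (by rw [Nat.add_comm, ← Nat.succ_mul]), hh, hiff.trans ⟨?_, ?_⟩⟩
      · rintro ⟨r', hr', hF', hk⟩
        refine ⟨r', by omega, hF', fun k hk1 hk2 => ?_⟩
        obtain rfl | hlt := hk1.eq_or_lt
        · by_contra hd3
          exact hd3 (hd (hlow r (by omega)))
        · exact hk k hlt hk2
      · rintro ⟨r', hr', hF', hk⟩
        obtain rfl | hlt := hr'.eq_or_lt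
        · exact absurd hF' hF
        · exact ⟨r', hlt, hF', fun k hk1 hk2 => hk k (by omega) hk2⟩

theorem searchProg_form {q q' : SearchState} {c : Fin 3} (i : ℕ) (hq : searchProg.Running q)
    (h1 : searchProg.δ q (.sym c) none = ⟨q', none, .right, .stay, none⟩)
    (h2 : ∀ a, a ≠ .sym c → searchProg.δ q a none = ⟨.rej, none, .stay, .stay, none⟩) :
    searchProg.Reaches B w S 1 ⟨q, i + 1, tape [], 0, []⟩
      (if w[i]? = some c then ⟨q', i + 2, tape [], 0, []⟩ else ⟨.rej, i + 1, tape [], 0, []⟩) := by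
  split_ifs with h
  · exact Prog.Reaches.keep hq (tape_zero _) (by rw [inputRead_of_getElem? h]; exact h1)
      rfl rfl (Nat.zero_le _) rfl
  · refine Prog.Reaches.keep hq (tape_zero _) (h2 _ fun h3 => h ?_) rfl rfl (Nat.zero_le _) rfl
    simp only [inputRead, Nat.succ_ne_zero, if_false, Nat.add_sub_cancel] at h3
    cases hw : w[i]? <;> simp_all

theorem searchProg_form4 (b a : List (Fin 3)) :
    searchProg.Reaches B (a ++ b) S (b.length + 1) ⟨.form4, a.length + 1, tape [], 0, []⟩
      (if ∀ g ∈ b, g ≠ 2 then ⟨.toEnd false, (a ++ b).length + 1, tape [], 0, []⟩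
        else ⟨.rej, a.length + b.idxOf 2 + 1, tape [], 0, []⟩) := by
  induction b generalizing a with
  | nil =>
    rw [if_pos (by simp), List.append_nil]
    exact Prog.Reaches.keep ⟨nofun, nofun, nofun⟩ (tape_zero _) (by rw [inputRead_end]; rfl)
      rfl rfl (Nat.zero_le _) rfl
  | cons g b ih =>
    by_cases hg : g = 2
    · subst hg
      rw [if_neg (by simp)]
      refine Prog.Reaches.mono (T := 1) ?_ (by omega)
      exact Prog.Reaches.keep (mi := .stay) (mw := .stay) (qw := none) ⟨nofun, nofun, nofun⟩
        (tape_zero _) (by rw [inputRead_append]; rfl) (by simp) rfl (Nat.zero_le _) rfl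
    · have h1 : searchProg.Reaches B (a ++ g :: b) S 1 ⟨.form4, a.length + 1, tape [], 0, []⟩
          ⟨.form4, a.length + 1 + 1, tape [], 0, []⟩ := by
        refine Prog.Reaches.keep (mi := .right) (mw := .stay) (qw := none)
          ⟨nofun, nofun, nofun⟩ (tape_zero _) ?_ rfl rfl (Nat.zero_le _) rfl
        rw [inputRead_append]
        revert hg
        fin_cases g <;> simp [searchProg]
      have h2 := ih (a ++ [g])
      refine Prog.Reaches.mono (T := 1 + (b.length + 1)) (h1.trans ?_) (by simp [Nat.add_comm])
      convert h2 using 1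
      · simp
      · simp
      · simp [hg, List.idxOf_cons_ne _ hg, ← Nat.add_assoc, Nat.add_right_comm]

/-- The words `101v` over the binary alphabet. -/
def Formatted (w : List (Fin 3)) : Prop :=
  ∃ v, w = 1 :: 0 :: 1 :: v ∧ ∀ g ∈ v, g ≠ 2

theorem searchProg_format :
    (Formatted w ∧ searchProg.Reaches B w S (w.length + 5) ⟨.start, 0, tape [], 0, []⟩
      ⟨.toEnd false, w.length + 1, tape [], 0, []⟩) ∨
    (¬ Formatted w ∧ ∃ s, s.state = .rej ∧
      searchProg.Reaches B w S (w.length + 5) ⟨.start, 0, tape [], 0, []⟩ s) := by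
  have hs : searchProg.Reaches B w S 1 ⟨.start, 0, tape [], 0, []⟩ ⟨.form1, 1, tape [], 0, []⟩ :=
    Prog.Reaches.keep (mi := .right) (mw := .stay) (qw := none) ⟨nofun, nofun, nofun⟩
      (tape_zero _) rfl rfl rfl (Nat.zero_le _) rfl
  have h1 := hs.trans (searchProg_form (B := B) (w := w) (S := S) (q := .form1) (q' := .form2)
    (c := 1) 0 ⟨nofun, nofun, nofun⟩ rfl (by
      rintro (_ | _ | a) ha
      · rfl
      · rfl
      · revert ha; fin_cases a <;> simp [searchProg]))
  by_cases c1 : w[0]? = some 1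
  swap
  · rw [if_neg c1] at h1
    refine .inr ⟨?_, _, rfl, h1.mono (by omega)⟩
    rintro ⟨v, rfl, -⟩
    exact c1 rfl
  rw [if_pos c1] at h1
  have h2 := h1.trans (searchProg_form (B := B) (w := w) (S := S) (q := .form2) (q' := .form3)
    (c := 0) 1 ⟨nofun, nofun, nofun⟩ rfl (by
      rintro (_ | _ | a) ha
      · rfl
      · rfl
      · revert ha; fin_cases a <;> simp [searchProg]))
  by_cases c2 : w[1]? = some 0
  swap
  · rw [if_neg c2] at h2
    refine .inr ⟨?_, _, rfl, h2.mono (by omega)⟩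
    rintro ⟨v, rfl, -⟩
    exact c2 rfl
  rw [if_pos c2] at h2
  have h3 := h2.trans (searchProg_form (B := B) (w := w) (S := S) (q := .form3) (q' := .form4)
    (c := 1) 2 ⟨nofun, nofun, nofun⟩ rfl (by
      rintro (_ | _ | a) ha
      · rfl
      · rfl
      · revert ha; fin_cases a <;> simp [searchProg]))
  by_cases c3 : w[2]? = some 1
  swap
  · rw [if_neg c3] at h3
    refine .inr ⟨?_, _, rfl, h3.mono (by omega)⟩
    rintro ⟨v, rfl, -⟩
    exact c3 rfl
  rw [if_pos c3] at h3
  obtain ⟨v, rfl⟩ : ∃ v, w = 1 :: 0 :: 1 :: v := by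
    rcases w with _ | ⟨a, _ | ⟨b, _ | ⟨c, v⟩⟩⟩ <;> simp_all
  have h4 := h3.trans (searchProg_form4 (B := B) (S := S) v [1, 0, 1])
  by_cases c4 : ∀ g ∈ v, g ≠ 2
  · rw [if_pos c4] at h4
    exact .inl ⟨⟨v, rfl, c4⟩, h4.mono (by simp; omega)⟩
  · rw [if_neg c4] at h4
    refine .inr ⟨?_, _, rfl, h4.mono (by simp; omega)⟩
    rintro ⟨v', hv, h⟩
    simp only [List.cons.injEq, true_and] at hv
    exact c4 (hv ▸ h)

theorem length_emb (x : List Bool) : (emb x).length = x.length := by simp [emb]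

theorem length_word1 (i : ℕ) (x : List Bool) : (word1 i x).length = i + x.length + 2 := by
  simp [word1, length_emb]

theorem ne_two_of_mem_emb {x : List Bool} {g : Fin 3} (h : g ∈ emb x) : g ≠ 2 := by
  obtain ⟨b, -, rfl⟩ := List.mem_map.1 h
  cases b <;> decide

theorem ubits_eq_answers (i : ℕ) (x : List Bool) :
    ubits B i x = answers B (word1 i x) (rlen x) (rlen x) := rfl

theorem rlen_le_iff (x : List Bool) (r : ℕ) : rlen x ≤ r ↔ x.length ≤ r * r := by
  rw [rlen, Nat.ceil_le, Real.sqrt_le_left (Nat.cast_nonneg r), sq]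
  exact_mod_cast Iff.rfl

theorem formatted_of_mem_L1 (h : w ∈ L1 B) : Formatted w := by
  obtain ⟨i, hi, x, rfl, -⟩ := h
  obtain ⟨i, rfl⟩ := Nat.exists_eq_add_of_le' hi
  refine ⟨List.replicate i 1 ++ emb x, rfl, fun g hg => ?_⟩
  obtain hg | hg := List.mem_append.1 hg
  · obtain rfl := List.eq_of_mem_replicate hg
    decide
  · exact ne_two_of_mem_emb hg

theorem found_of_mem_L1 (h : w ∈ L1 B) : ∃ r, Found B w r ∧ ∀ k < r, 3 < w.length - k * k := by
  obtain ⟨i, hi, x, rfl, hB⟩ := h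
  have hr := (rlen_le_iff x _).1 le_rfl
  refine ⟨rlen x, ⟨fun k hk2 hk => ?_, by rwa [← ubits_eq_answers]⟩, fun k hk => ?_⟩
  · rw [length_word1] at hk
    obtain ⟨k, rfl⟩ := Nat.exists_eq_add_of_le' hk2
    have hki : k < i := by omega
    simp [word1, List.getElem?_append, hki]
  · have := mt (rlen_le_iff x k).2 (by omega)
    rw [length_word1]
    omega

theorem mem_L1_of_found (hw : Formatted w) {r : ℕ} (hF : Found B w r)
    (hr : ∀ k < r, 3 < w.length - k * k) : w ∈ L1 B := by
  obtain ⟨v, rfl, hv⟩ := hw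
  obtain ⟨hlow, hB⟩ := hF
  set e := v.length - r * r with he
  have hl : (1 :: 0 :: 1 :: v : List (Fin 3)).length = v.length + 3 := rfl
  have h1 : v.take e = List.replicate e 1 := by
    refine List.eq_replicate_iff.2 ⟨by simp; omega, fun g hg => ?_⟩
    obtain ⟨k, hk, rfl⟩ := List.mem_take_iff_getElem.1 hg
    have := hlow (k + 3) (by omega) (by omega)
    obtain ⟨_, h⟩ : ∃ h : k < v.length, v[k] = 1 := by
      simpa [List.getElem?_eq_some_iff] using this
    exact h
  set x : List Bool := (v.drop e).map fun g => decide (g = 1) with hx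
  have h2 : emb x = v.drop e := by
    rw [hx, emb, List.map_map]
    refine (List.map_congr_left fun g hg => ?_).trans (List.map_id _)
    have := hv g (List.mem_of_mem_drop hg)
    revert this
    fin_cases g <;> simp
  have h3 : word1 (e + 1) x = 1 :: 0 :: 1 :: v := by
    rw [word1, h2, List.replicate_succ, ← h1, List.cons_append, List.take_append_drop]
  have h4 : x.length = v.length - e := by simp [hx]
  have h5 : rlen x = r := by
    refine le_antisymm ((rlen_le_iff x r).2 (by omega)) (le_of_not_gt fun h => ?_)
    obtain ⟨s, rfl⟩ := Nat.exists_eq_add_of_lt (Nat.zero_lt_of_lt h)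
    have h6 := (rlen_le_iff x _).1 (Nat.le_of_lt_succ h)
    have h7 := hr (0 + s) (by omega)
    have h8 : (0 + s) * (0 + s) < (0 + s + 1) * (0 + s + 1) :=
      Nat.mul_self_lt_mul_self (by omega)
    omega
  exact ⟨e + 1, by omega, x, h3.symm, by rwa [ubits_eq_answers, h3, h5]⟩

theorem searchProg_correct (hS : Nat.sqrt w.length + 2 ≤ S) :
    ∃ s, searchProg.Reaches B w S (w.length + 5 +
        (Nat.sqrt w.length + 2) * iterTime w.length (Nat.sqrt w.length + 1))
        ⟨.start, 0, fun _ => none, 0, []⟩ s ∧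
      (s.state = .acc ∨ s.state = .rej) ∧ (w ∈ L1 B ↔ s.state = .acc) := by
  rw [← tape_nil]
  obtain ⟨hw, h⟩ | ⟨hw, s, hs, h⟩ := searchProg_format (B := B) (w := w) (S := S)
  · have hsq := Nat.lt_succ_sqrt w.length
    obtain ⟨s, h', hh, hiff⟩ := searchProg_loop (B := B) (w := w) (S := S)
      (f := Nat.sqrt w.length + 1) (r := 0) (i := w.length + 1)
      (by simp only [Nat.zero_add, Nat.succ_eq_add_one] at hsq ⊢; omega) le_rfl (by omega)
      (by obtain ⟨v, rfl, -⟩ := hw; rfl) (by obtain ⟨v, rfl, -⟩ := hw; rfl)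
      (by obtain ⟨v, rfl, -⟩ := hw; rfl)
    rw [Nat.zero_add] at h'
    refine ⟨s, h.trans h', hh, ?_⟩
    rw [hiff]
    constructor
    · intro hL
      obtain ⟨r, hF, hr⟩ := found_of_mem_L1 hL
      exact ⟨r, Nat.zero_le _, hF, fun k _ => hr k⟩
    · rintro ⟨r, -, hF, hr⟩
      exact mem_L1_of_found hw hF fun k => hr k (Nat.zero_le _)
  · exact ⟨s, h.mono (Nat.le_add_right _ _), .inr hs,
      iff_of_false (fun hL => hw (formatted_of_mem_L1 hL)) (by rw [hs]; nofun)⟩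

theorem searchTime_le (n : ℕ) :
    n + 5 + (Nat.sqrt n + 2) * iterTime n (Nat.sqrt n + 1) ≤ (n * n + 2) ^ 12 := by
  have h1 : Nat.sqrt n ≤ n := Nat.sqrt_le_self n
  set N := n * n + 2 with hN
  have h2 : n + 1 ≤ N := by nlinarith
  have h3 : 2 ≤ N := by omega
  have hN1 : 1 ≤ N := by omega
  have hi : iterTime n (Nat.sqrt n + 1) ≤ 90 * N ^ 2 := by
    have : n + (Nat.sqrt n + 1) + 2 ≤ 3 * N := by omega
    calc 10 * (n + (Nat.sqrt n + 1) + 2) ^ 2 ≤ 10 * (3 * N) ^ 2 := by gcongr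
      _ = 90 * N ^ 2 := by ring
  calc n + 5 + (Nat.sqrt n + 2) * iterTime n (Nat.sqrt n + 1)
      ≤ 3 * N + 2 * N * (90 * N ^ 2) := by gcongr <;> omega
    _ ≤ 3 * N ^ 3 + 2 * N * (90 * N ^ 2) := by
        gcongr; exact Nat.le_self_pow (by norm_num) N
    _ = 183 * N ^ 3 := by ring
    _ ≤ 2 ^ 9 * N ^ 3 := by gcongr; norm_num
    _ ≤ N ^ 9 * N ^ 3 := by gcongr
    _ = N ^ 12 := by ring

end SearchProg

/-- For every oracle `B`, `(L₁^B, ||) ∈ PsubLIN^B`. -/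
theorem stmt12 (B : Set (List (Fin 3))) :
    (L1 B, fun w : List (Fin 3) => w.length) ∈ PsubLIN (1 : Fin 3) B := by
  refine ⟨logSpaceSizeParam_length, searchProg.toOTM, 12, 0, 1 / 2, by norm_num, by norm_num, ?_⟩
  intro w
  obtain ⟨s, h, hh, hiff⟩ := searchProg_correct (B := B) (w := w) le_rfl
  obtain ⟨t, ht, hm, hst, -⟩ := h.cfgAt
  have hacc : (searchProg.toOTM.cfgAt B w t).state = searchProg.toOTM.qacc ↔ s.state = .acc := by
    rw [hst]; exact (Fintype.equivFin SearchState).apply_eq_iff_eq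
  have hrej : (searchProg.toOTM.cfgAt B w t).state = searchProg.toOTM.qrej ↔ s.state = .rej := by
    rw [hst]; exact (Fintype.equivFin SearchState).apply_eq_iff_eq
  refine ⟨t, ?_, hh.imp hacc.2 hrej.2, ?_, hiff.trans hacc.symm⟩
  · have hb : t ≤ (w.length * w.length + 2) ^ 12 := ht.trans (searchTime_le _)
    simp only [polyB]
    exact_mod_cast hb
  · have h1 : (Nat.sqrt w.length : ℝ) ≤ Real.sqrt w.length := Real.nat_sqrt_le_real_sqrt
    have h2 : ((searchProg.toOTM.cfgAt B w t).maxw : ℝ) ≤ Nat.sqrt w.length + 2 := by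
      exact_mod_cast hm
    have h3 := Real.sqrt_nonneg (w.length : ℝ)
    beta_reduce
    rw [← Real.sqrt_eq_rpow, pow_zero]
    push_cast
    linarith
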